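/- arXiv:1706.05496 — 2 statements merged into one kernel-verified Lean document; each statement's English description precedes it below -/
import Mathlib

section
/- Let G₁ = (V₁,E₁) and G₂ = (V₂,E₂) be vertex-disjoint graphs and let u ∈ V₁. Let G = 𝒮(G₁, u, G₂) be the graph obtained by substituting G₂ in G₁ at u. Then xc(STAB(G)) ≤ xc(STAB(G₁)) + xc(STAB(G₂)). -/
/-- A polytope is the convex hull of a finite set of points. -/
def IsPolytope {E : Type*} [AddCommGroup E] [Module ℝ E] (P : Set E) : Prop :=
  ∃ F : Set E, F.Finite ∧ P = convexHull ℝ F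

/-- An (exposed) face of a set `Q ⊆ ℝ^κ`. -/
def IsExposedFace {κ : Type*} [Fintype κ] (Q F : Set (κ → ℝ)) : Prop :=
  F ⊆ Q ∧ ∃ (c : κ → ℝ) (α : ℝ), (∀ y ∈ Q, ∑ i, c i * y i ≤ α) ∧
    F = {y ∈ Q | ∑ i, c i * y i = α}

/-- A facet of `Q`: a maximal proper nonempty face of `Q`. -/
def IsFacet {κ : Type*} [Fintype κ] (Q F : Set (κ → ℝ)) : Prop :=
  IsExposedFace Q F ∧ F.Nonempty ∧ F ≠ Q ∧
    ∀ F' : Set (κ → ℝ), IsExposedFace Q F' → F'.Nonempty → F' ≠ Q → F ⊆ F' → F' = F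

/-- The size of a polytope: its number of facets. -/
noncomputable def polySize {κ : Type*} [Fintype κ] (Q : Set (κ → ℝ)) : ℕ :=
  {F : Set (κ → ℝ) | IsFacet Q F}.ncard

/-- `Q` is an extension of `P` if `Q` is a polytope and some linear map sends `Q` onto `P`. -/
def IsExtension {ι κ : Type*} [Fintype ι] [Fintype κ]
    (P : Set (ι → ℝ)) (Q : Set (κ → ℝ)) : Prop :=
  IsPolytope Q ∧ ∃ π : (κ → ℝ) →ₗ[ℝ] (ι → ℝ), π '' Q = P

/-- The extension complexity of `P`: the minimum number of facets of an extension of `P`. -/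
noncomputable def xc {ι : Type*} [Fintype ι] (P : Set (ι → ℝ)) : ℕ :=
  sInf {r : ℕ | ∃ (k : ℕ) (Q : Set (Fin k → ℝ)), IsExtension P Q ∧ polySize Q = r}

/-- The stable set polytope of a graph: the convex hull of the characteristic vectors of
its independent (stable) sets. -/
def stab {V : Type*} [Fintype V] (G : SimpleGraph V) : Set (V → ℝ) :=
  convexHull ℝ {x : V → ℝ |
    ∃ S : Set V, (∀ u ∈ S, ∀ v ∈ S, ¬ G.Adj u v) ∧ x = S.indicator 1}

/-- The graph obtained by substituting `G₂` in `G₁` at the vertex `u`: its vertices are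
`(V₁ \\ {u}) ⊕ V₂`, with the edges of `G₁` among `V₁ \\ {u}`, the edges of `G₂`, and all
pairs `{v, w}` with `v ∈ V₂`, `w ∈ V₁ \\ {u}` such that `{u, w}` is an edge of `G₁`. -/
def substGraph {V₁ V₂ : Type*} (G₁ : SimpleGraph V₁) (u : V₁) (G₂ : SimpleGraph V₂) :
    SimpleGraph ({v : V₁ // v ≠ u} ⊕ V₂) :=
  SimpleGraph.fromRel fun a b =>
    match a, b with
    | Sum.inl v, Sum.inl w => G₁.Adj v.1 w.1
    | Sum.inl v, Sum.inr _ => G₁.Adj u v.1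
    | Sum.inr _, Sum.inl w => G₁.Adj u w.1
    | Sum.inr x, Sum.inr y => G₂.Adj x y

/-- The join-type set used to build the extension. -/
def jn {E₁ E₂ : Type*} [AddCommGroup E₁] [Module ℝ E₁] [AddCommGroup E₂] [Module ℝ E₂]
    (t : E₁ →ₗ[ℝ] ℝ) (A : Set E₁) (B : Set E₂) : Set (E₁ × E₂) :=
  {p | ∃ a ∈ A, ∃ w ∈ B, p = (a, t a • w)}

section Join
variable {E₁ E₂ : Type*} [AddCommGroup E₁] [Module ℝ E₁] [AddCommGroup E₂] [Module ℝ E₂]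

lemma jn_mono (t : E₁ →ₗ[ℝ] ℝ) {A A' : Set E₁} {B B' : Set E₂} (h : A ⊆ A') (h' : B ⊆ B') :
    jn t A B ⊆ jn t A' B' := by
  rintro p ⟨a, ha, w, hw, rfl⟩
  exact ⟨a, h ha, w, h' hw, rfl⟩

lemma jn_convex (t : E₁ →ₗ[ℝ] ℝ) {A : Set E₁} {B : Set E₂} (hA : Convex ℝ A) (hB : Convex ℝ B)
    (ht : ∀ a ∈ A, 0 ≤ t a) : Convex ℝ (jn t A B) := by
  rintro p ⟨a, ha, w, hw, rfl⟩ q ⟨a', ha', w', hw', rfl⟩ x y hx hy hxy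
  have h1 : 0 ≤ x * t a := mul_nonneg hx (ht a ha)
  have h2 : 0 ≤ y * t a' := mul_nonneg hy (ht a' ha')
  rcases eq_or_lt_of_le (add_nonneg h1 h2) with h | h
  · have e1 : x * t a = 0 := by linarith
    have e2 : y * t a' = 0 := by linarith
    refine ⟨x • a + y • a', hA ha ha' hx hy hxy, w, hw, ?_⟩
    simp [smul_smul, e1, e2]
  · refine ⟨x • a + y • a', hA ha ha' hx hy hxy,
      (x * t a / (x * t a + y * t a')) • w + (y * t a' / (x * t a + y * t a')) • w',
      hB hw hw' (by positivity) (by positivity) (by field_simp), ?_⟩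
    have h3 := h.ne'
    simp only [Prod.smul_mk, Prod.mk_add_mk, map_add, map_smul, smul_eq_mul, smul_add, smul_smul]
    congr 3
    · field_simp
    · field_simp

lemma jn_convexHull (t : E₁ →ₗ[ℝ] ℝ) (A : Set E₁) (B : Set E₂)
    (ht : ∀ a ∈ convexHull ℝ A, 0 ≤ t a) :
    jn t (convexHull ℝ A) (convexHull ℝ B) = convexHull ℝ (jn t A B) := by
  apply Set.Subset.antisymm
  · rintro p ⟨a, ha, w, hw, rfl⟩
    have key : ∀ a ∈ A, ∀ w ∈ convexHull ℝ B, (a, t a • w) ∈ convexHull ℝ (jn t A B) := by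
      intro a ha
      have : convexHull ℝ B ⊆ {w | (a, t a • w) ∈ convexHull ℝ (jn t A B)} := by
        apply convexHull_min
        · intro w hw
          exact subset_convexHull ℝ _ ⟨a, ha, w, hw, rfl⟩
        · intro w hw w' hw' x y hx hy hxy
          have := convex_convexHull ℝ (jn t A B) hw hw' hx hy hxy
          simp only [Set.mem_ofPred_eq]
          convert this using 1
          ext
          · simp [← add_smul, hxy]
          · simp [smul_smul, mul_comm]
      exact this
    have : convexHull ℝ A ⊆ {a | (a, t a • w) ∈ convexHull ℝ (jn t A B)} := by
      apply convexHull_min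
      · intro a ha
        exact key a ha w hw
      · intro a ha a' ha' x y hx hy hxy
        have := convex_convexHull ℝ (jn t A B) ha ha' hx hy hxy
        simp only [Set.mem_ofPred_eq]
        convert this using 1
        ext
        · simp
        · simp [smul_smul, add_smul]
    exact this ha
  · exact convexHull_min (jn_mono t (subset_convexHull ℝ A) (subset_convexHull ℝ B))
      (jn_convex t (convex_convexHull ℝ A) (convex_convexHull ℝ B) ht)

lemma jn_finite (t : E₁ →ₗ[ℝ] ℝ) {A : Set E₁} {B : Set E₂} (hA : A.Finite) (hB : B.Finite) :
    (jn t A B).Finite := by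
  refine ((hA.prod hB).image (fun p : E₁ × E₂ => (p.1, t p.1 • p.2))).subset ?_
  rintro p ⟨a, ha, w, hw, rfl⟩
  exact ⟨(a, w), ⟨ha, hw⟩, rfl⟩

lemma jn_left_sub (t : E₁ →ₗ[ℝ] ℝ) {A A' : Set E₁} {B B' : Set E₂} (hB : B.Nonempty)
    (h : jn t A B ⊆ jn t A' B') : A ⊆ A' := by
  intro a ha
  obtain ⟨w, hw⟩ := hB
  obtain ⟨a', ha', w', hw', e⟩ := h ⟨a, ha, w, hw, rfl⟩
  rw [Prod.mk.injEq] at e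
  rw [e.1]; exact ha'

lemma jn_right_sub (t : E₁ →ₗ[ℝ] ℝ) {A A' : Set E₁} {B B' : Set E₂} {a : E₁} (ha : a ∈ A)
    (hta : t a ≠ 0) (h : jn t A B ⊆ jn t A' B') : B ⊆ B' := by
  intro w hw
  obtain ⟨a', ha', w', hw', e⟩ := h ⟨a, ha, w, hw, rfl⟩
  rw [Prod.mk.injEq] at e
  obtain ⟨rfl, e⟩ := e
  rw [smul_right_injective E₂ hta e]; exact hw'

end Join

/-- The linear isomorphism gluing two coordinate vectors. -/
def glue (k l : ℕ) : ((Fin k → ℝ) × (Fin l → ℝ)) ≃ₗ[ℝ] (Fin (k + l) → ℝ) where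
  toFun p := Fin.append p.1 p.2
  invFun y := (fun i => y (Fin.castAdd l i), fun i => y (Fin.natAdd k i))
  map_add' p q := by
    ext i
    refine Fin.addCases (fun i => ?_) (fun i => ?_) i <;> simp
  map_smul' c p := by
    ext i
    refine Fin.addCases (fun i => ?_) (fun i => ?_) i <;> simp
  left_inv p := by ext i <;> simp
  right_inv y := by
    ext i
    refine Fin.addCases (fun i => ?_) (fun i => ?_) i <;> simp

lemma sum_glue {k l : ℕ} (c : Fin (k + l) → ℝ) (p : (Fin k → ℝ) × (Fin l → ℝ)) :
    ∑ i, c i * glue k l p i =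
      ∑ i, c (Fin.castAdd l i) * p.1 i + ∑ i, c (Fin.natAdd k i) * p.2 i := by
  simp [Fin.sum_univ_add, glue]

lemma facets_finite {κ : Type*} [Fintype κ] {Q : Set (κ → ℝ)} (hQ : IsPolytope Q) :
    {F : Set (κ → ℝ) | IsFacet Q F}.Finite := by
  obtain ⟨V, hV, rfl⟩ := hQ
  refine (hV.finite_subsets.image (fun W => convexHull ℝ W)).subset ?_
  rintro F ⟨⟨hF, c, α, hle, rfl⟩, -⟩
  refine ⟨{v ∈ V | ∑ i, c i * v i = α}, Set.sep_subset _ _, ?_⟩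
  apply Set.Subset.antisymm
  · apply convexHull_min
    · exact fun v hv => ⟨subset_convexHull ℝ _ hv.1, hv.2⟩
    · refine (convex_convexHull ℝ V).inter ?_
      have : IsLinearMap ℝ (fun y : κ → ℝ => ∑ i, c i * y i) :=
        ⟨fun x y => by simp [mul_add, Finset.sum_add_distrib],
         fun a x => by simp [Finset.mul_sum, mul_left_comm]⟩
      exact convex_hyperplane this α
  · rintro y ⟨hy, hyα⟩
    lift V to Finset (κ → ℝ) using hV
    rw [Finset.convexHull_eq] at hy
    obtain ⟨w, hw0, hw1, rfl⟩ := hy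
    rw [Finset.centerMass_eq_of_sum_1 _ _ hw1] at hyα ⊢
    have hsum : ∑ v ∈ V, w v * (α - ∑ i, c i * v i) = 0 := by
      have : ∑ v ∈ V, w v * ∑ i, c i * v i = α := by
        rw [← hyα]
        simp only [Finset.sum_apply, Pi.smul_apply, smul_eq_mul, id, Finset.mul_sum]
        rw [Finset.sum_comm]
        refine Finset.sum_congr rfl fun i _ => Finset.sum_congr rfl fun v _ => by ring
      simp only [mul_sub, Finset.sum_sub_distrib, ← Finset.sum_mul, hw1, this]
      ring
    have hz := (Finset.sum_eq_zero_iff_of_nonneg (fun v hv => mul_nonneg (hw0 v hv)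
      (sub_nonneg.2 (hle v (subset_convexHull ℝ _ hv))))).1 hsum
    have hd : ∀ v ∈ V, w v ≠ 0 → ∑ i, c i * v i = α := by
      intro v hv hne
      have := (mul_eq_zero.1 (hz v hv)).resolve_left hne
      linarith
    classical
    have e : ∑ v ∈ V, w v • id v = ∑ v ∈ V with w v ≠ 0, w v • id v := by
      symm
      apply Finset.sum_filter_of_ne
      intro v _ h h0
      simp [h0] at h
    rw [e]
    refine (convex_convexHull ℝ _).sum_mem (fun v hv => hw0 v (Finset.mem_filter.1 hv).1) ?_ ?_
    · rw [Finset.sum_filter_ne_zero]; exact hw1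
    · intro v hv
      rw [Finset.mem_filter] at hv
      exact subset_convexHull ℝ _ ⟨hv.1, hd v hv.1 hv.2⟩

section Faces
variable {k l : ℕ} (t : (Fin k → ℝ) →ₗ[ℝ] ℝ) {A : Set (Fin k → ℝ)} {B : Set (Fin l → ℝ)}

lemma face_left {F : Set (Fin k → ℝ)} (hF : IsExposedFace A F) :
    IsExposedFace (glue k l '' jn t A B) (glue k l '' jn t F B) := by
  obtain ⟨hs, c, α, hle, e⟩ := hF
  refine ⟨Set.image_mono (jn_mono t hs subset_rfl), Fin.append c 0, α, ?_, ?_⟩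
  · rintro _ ⟨_, ⟨a, ha, w, hw, rfl⟩, rfl⟩
    rw [sum_glue]
    simpa using hle a ha
  · ext y
    constructor
    · rintro ⟨_, ⟨a, ha, w, hw, rfl⟩, rfl⟩
      refine ⟨⟨_, ⟨a, hs ha, w, hw, rfl⟩, rfl⟩, ?_⟩
      rw [e] at ha
      rw [sum_glue]
      simpa using ha.2
    · rintro ⟨⟨_, ⟨a, ha, w, hw, rfl⟩, rfl⟩, h⟩
      rw [sum_glue] at h
      refine ⟨_, ⟨a, ?_, w, hw, rfl⟩, rfl⟩
      rw [e]
      exact ⟨ha, by simpa using h⟩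

lemma t_eq_sum (a : Fin k → ℝ) : t a = ∑ i, t (Pi.single i 1) * a i := by
  rw [LinearMap.pi_apply_eq_sum_univ t a]
  refine Finset.sum_congr rfl fun i _ => ?_
  rw [smul_eq_mul, mul_comm]
  congr 2
  ext j
  simp [Pi.single_apply, eq_comm]

lemma face_right (ht : ∀ a ∈ A, 0 ≤ t a) {F : Set (Fin l → ℝ)} (hF : IsExposedFace B F)
    (hne : F.Nonempty) :
    IsExposedFace (glue k l '' jn t A B) (glue k l '' jn t A F) := by
  obtain ⟨hs, c, α, hle, e⟩ := hF
  have hsum : ∀ a w, ∑ i, (Fin.append (fun i => -α * t (Pi.single i 1)) c : Fin (k + l) → ℝ) i *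
      glue k l (a, t a • w) i = t a * (∑ i, c i * w i - α) := by
    intro a w
    rw [sum_glue]
    have : ∑ i, -α * t (Pi.single i 1) * a i = -α * t a := by
      rw [t_eq_sum t a, Finset.mul_sum]
      exact Finset.sum_congr rfl fun i _ => by ring
    have h2 : ∑ i, c i * (t a * w i) = t a * ∑ i, c i * w i := by
      rw [Finset.mul_sum]
      exact Finset.sum_congr rfl fun i _ => by ring
    simp only [Fin.append_left, Fin.append_right, Pi.smul_apply, smul_eq_mul]
    rw [this, h2]
    ring
  refine ⟨Set.image_mono (jn_mono t subset_rfl hs),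
    Fin.append (fun i => -α * t (Pi.single i 1)) c, 0, ?_, ?_⟩
  · rintro _ ⟨_, ⟨a, ha, w, hw, rfl⟩, rfl⟩
    rw [hsum]
    exact mul_nonpos_of_nonneg_of_nonpos (ht a ha) (by linarith [hle w hw])
  · ext y
    constructor
    · rintro ⟨_, ⟨a, ha, w, hw, rfl⟩, rfl⟩
      refine ⟨⟨_, ⟨a, ha, w, hs hw, rfl⟩, rfl⟩, ?_⟩
      rw [e] at hw
      rw [hsum, hw.2]
      simp
    · rintro ⟨⟨_, ⟨a, ha, w, hw, rfl⟩, rfl⟩, h⟩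
      rw [hsum] at h
      rcases mul_eq_zero.1 h with h | h
      · obtain ⟨w', hw'⟩ := hne
        exact ⟨_, ⟨a, ha, w', hw', rfl⟩, by simp [h]⟩
      · refine ⟨_, ⟨a, ha, w, ?_, rfl⟩, rfl⟩
        rw [e]
        exact ⟨hw, by linarith⟩

lemma face_decomp (ht : ∀ a ∈ A, 0 ≤ t a) (hB : IsCompact B) (hBn : B.Nonempty)
    {F : Set (Fin (k + l) → ℝ)} (hF : IsExposedFace (glue k l '' jn t A B) F) :
    ∃ F₁ F₂, IsExposedFace A F₁ ∧ IsExposedFace B F₂ ∧ F₂.Nonempty ∧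
      F = glue k l '' jn t F₁ F₂ := by
  obtain ⟨hs, c, α, hle, e⟩ := hF
  obtain ⟨m, hm, hmax⟩ := hB.exists_isMaxOn hBn
    (f := fun w => ∑ i, c (Fin.natAdd k i) * w i) (by fun_prop)
  have hmax' : ∀ w ∈ B, ∑ i, c (Fin.natAdd k i) * w i ≤ ∑ i, c (Fin.natAdd k i) * m i := hmax
  set M := ∑ i, c (Fin.natAdd k i) * m i with hM
  have hsum : ∀ a w, ∑ i, c i * glue k l (a, t a • w) i =
      ∑ i, c (Fin.castAdd l i) * a i + t a * ∑ i, c (Fin.natAdd k i) * w i := by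
    intro a w
    rw [sum_glue]
    congr 1
    rw [Finset.mul_sum]
    exact Finset.sum_congr rfl fun i _ => by simp; ring
  have hsum1 : ∀ a, ∑ i, (c (Fin.castAdd l i) + M * t (Pi.single i 1)) * a i =
      ∑ i, c (Fin.castAdd l i) * a i + t a * M := by
    intro a
    rw [t_eq_sum t a, Finset.sum_mul, ← Finset.sum_add_distrib]
    exact Finset.sum_congr rfl fun i _ => by ring
  have hA : ∀ a ∈ A, ∑ i, c (Fin.castAdd l i) * a i + t a * M ≤ α := by
    intro a ha
    have := hle _ ⟨_, ⟨a, ha, m, hm, rfl⟩, rfl⟩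
    rwa [hsum] at this
  refine ⟨{a ∈ A | ∑ i, (c (Fin.castAdd l i) + M * t (Pi.single i 1)) * a i = α},
    {w ∈ B | ∑ i, c (Fin.natAdd k i) * w i = M},
    ⟨Set.sep_subset _ _, _, α, ?_, rfl⟩, ⟨Set.sep_subset _ _, _, M, hmax', rfl⟩,
    ⟨m, hm, rfl⟩, ?_⟩
  · intro a ha
    rw [hsum1]
    exact hA a ha
  · rw [e]
    ext y
    constructor
    · rintro ⟨⟨_, ⟨a, ha, w, hw, rfl⟩, rfl⟩, h⟩
      rw [hsum] at h
      have h1 := hA a ha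
      have h2 := mul_le_mul_of_nonneg_left (hmax' w hw) (ht a ha)
      have h3 : t a * (M - ∑ i, c (Fin.natAdd k i) * w i) = 0 := by linarith
      have haF : a ∈ {a ∈ A | ∑ i, (c (Fin.castAdd l i) + M * t (Pi.single i 1)) * a i = α} :=
        ⟨ha, by rw [hsum1]; linarith⟩
      rcases mul_eq_zero.1 h3 with h3 | h3
      · exact ⟨_, ⟨a, haF, m, ⟨hm, rfl⟩, rfl⟩, by simp [h3]⟩
      · exact ⟨_, ⟨a, haF, w, ⟨hw, by linarith⟩, rfl⟩, rfl⟩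
    · rintro ⟨_, ⟨a, ha, w, hw, rfl⟩, rfl⟩
      refine ⟨⟨_, ⟨a, ha.1, w, hw.1, rfl⟩, rfl⟩, ?_⟩
      rw [hsum, hw.2, ← hsum1, ha.2]

lemma glue_sub {S T : Set ((Fin k → ℝ) × (Fin l → ℝ))} (h : glue k l '' S ⊆ glue k l '' T) :
    S ⊆ T := (Set.image_subset_image_iff (glue k l).injective).1 h

lemma facet_decomp (ht : ∀ a ∈ A, 0 ≤ t a) (hB : IsCompact B) (hAn : A.Nonempty) (hBn : B.Nonempty)
    {F : Set (Fin (k + l) → ℝ)} (hF : IsFacet (glue k l '' jn t A B) F) :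
    (∃ F₁, IsFacet A F₁ ∧ F = glue k l '' jn t F₁ B) ∨
    (∃ F₂, IsFacet B F₂ ∧ F = glue k l '' jn t A F₂) := by
  obtain ⟨hF, hFn, hFp, hmax⟩ := hF
  obtain ⟨F₁, F₂, h1, h2, h2n, rfl⟩ := face_decomp t ht hB hBn hF
  have h1n : F₁.Nonempty := by
    obtain ⟨_, _, ⟨a, ha, -⟩, -⟩ := hFn
    exact ⟨a, ha⟩
  have jne : ∀ {A' : Set (Fin k → ℝ)} {B' : Set (Fin l → ℝ)}, A'.Nonempty → B'.Nonempty →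
      (glue k l '' jn t A' B').Nonempty := by
    rintro A' B' ⟨a, ha⟩ ⟨b, hb⟩
    exact ⟨_, _, ⟨a, ha, b, hb, rfl⟩, rfl⟩
  by_cases hp : F₁ = A
  · subst hp
    right
    obtain ⟨a, ha, hta⟩ : ∃ a ∈ F₁, t a ≠ 0 := by
      by_contra! hcon
      apply hFp
      congr 1
      refine Set.Subset.antisymm (jn_mono t subset_rfl h2.1) ?_
      rintro p ⟨a, ha, w, hw, rfl⟩
      obtain ⟨w', hw'⟩ := h2n
      exact ⟨a, ha, w', hw', by simp [hcon a ha]⟩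
    refine ⟨F₂, ⟨h2, h2n, ?_, ?_⟩, rfl⟩
    · rintro rfl
      exact hFp rfl
    · intro F' hF' hF'n hF'p hsub
      have := hmax _ (face_right t ht hF' hF'n) (jne h1n hF'n) ?_
        (Set.image_mono (jn_mono t subset_rfl hsub))
      · exact Set.Subset.antisymm (jn_right_sub t ha hta (glue_sub this.subset)) hsub
      · intro h
        exact hF'p (Set.Subset.antisymm hF'.1 (jn_right_sub t ha hta (glue_sub h.symm.subset)))
  · left
    have hprop : ∀ F' : Set (Fin k → ℝ), F' ⊆ A → F' ≠ A →
        glue k l '' jn t F' B ≠ glue k l '' jn t A B := by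
      intro F' hs hne h
      exact hne (Set.Subset.antisymm hs (jn_left_sub t hBn (glue_sub h.symm.subset)))
    have key : ∀ F' : Set (Fin k → ℝ), IsExposedFace A F' → F' ≠ A → F₁ ⊆ F' →
        glue k l '' jn t F' B = glue k l '' jn t F₁ F₂ := by
      intro F' hF' hne hsub
      exact hmax _ (face_left t hF') (jne (h1n.mono hsub) hBn) (hprop F' hF'.1 hne)
        (Set.image_mono (jn_mono t hsub h2.1))
    refine ⟨F₁, ⟨h1, h1n, hp, ?_⟩, (key F₁ h1 hp subset_rfl).symm⟩
    intro F' hF' _ hne hsub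
    exact Set.Subset.antisymm (jn_left_sub t hBn (glue_sub (key F' hF' hne hsub).subset)) hsub

lemma polySize_le (ht : ∀ a ∈ A, 0 ≤ t a) (hA : IsPolytope A) (hB : IsPolytope B)
    (hAn : A.Nonempty) (hBn : B.Nonempty) :
    polySize (glue k l '' jn t A B) ≤ polySize A + polySize B := by
  have fA := facets_finite hA
  have fB := facets_finite hB
  have hBc : IsCompact B := by
    obtain ⟨V, hV, rfl⟩ := hB
    exact hV.isCompact_convexHull ℝ
  unfold polySize
  calc _ ≤ ((fun F => glue k l '' jn t F B) '' {F | IsFacet A F} ∪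
        (fun F => glue k l '' jn t A F) '' {F | IsFacet B F}).ncard := by
        refine Set.ncard_le_ncard ?_ ((fA.image _).union (fB.image _))
        intro F hF
        rcases facet_decomp t ht hBc hAn hBn hF with ⟨F', h, rfl⟩ | ⟨F', h, rfl⟩
        · exact Or.inl ⟨F', h, rfl⟩
        · exact Or.inr ⟨F', h, rfl⟩
    _ ≤ _ := Set.ncard_union_le _ _
    _ ≤ _ := add_le_add (Set.ncard_image_le fA) (Set.ncard_image_le fB)

end Faces

lemma isPolytope_jn {k l : ℕ} (t : (Fin k → ℝ) →ₗ[ℝ] ℝ) {A : Set (Fin k → ℝ)}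
    {B : Set (Fin l → ℝ)} (ht : ∀ a ∈ A, 0 ≤ t a) (hA : IsPolytope A) (hB : IsPolytope B) :
    IsPolytope (glue k l '' jn t A B) := by
  obtain ⟨V, hV, rfl⟩ := hA
  obtain ⟨W, hW, rfl⟩ := hB
  refine ⟨glue k l '' jn t V W, (jn_finite t hV hW).image _, ?_⟩
  rw [jn_convexHull t V W ht]
  exact LinearMap.image_convexHull (glue k l).toLinearMap _

lemma xc_attained {ι : Type*} [Fintype ι] {P : Set (ι → ℝ)} (hP : IsPolytope P) :
    ∃ (k : ℕ) (Q : Set (Fin k → ℝ)), IsExtension P Q ∧ polySize Q = xc P := by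
  have : {r : ℕ | ∃ (k : ℕ) (Q : Set (Fin k → ℝ)), IsExtension P Q ∧ polySize Q = r}.Nonempty := by
    let e : (ι → ℝ) ≃ₗ[ℝ] (Fin (Fintype.card ι) → ℝ) :=
      LinearEquiv.funCongrLeft ℝ ℝ (Fintype.equivFin ι).symm
    refine ⟨_, Fintype.card ι, e '' P, ⟨?_, e.symm.toLinearMap, ?_⟩, rfl⟩
    · obtain ⟨V, hV, rfl⟩ := hP
      exact ⟨e '' V, hV.image _, LinearMap.image_convexHull e.toLinearMap _⟩
    · rw [Set.image_image]
      simp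
  exact Nat.sInf_mem this

lemma stab_isPolytope {V : Type*} [Fintype V] (G : SimpleGraph V) : IsPolytope (stab G) := by
  refine ⟨_, ?_, rfl⟩
  refine (Set.finite_range (fun S : Set V => (S.indicator 1 : V → ℝ))).subset ?_
  rintro x ⟨S, -, rfl⟩
  exact ⟨S, rfl⟩

lemma stab_nonempty {V : Type*} [Fintype V] (G : SimpleGraph V) : (stab G).Nonempty :=
  ⟨_, subset_convexHull ℝ _ ⟨∅, by simp, rfl⟩⟩

lemma stab_nonneg {V : Type*} [Fintype V] (G : SimpleGraph V) (u : V) :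
    ∀ x ∈ stab G, 0 ≤ x u := by
  have : stab G ⊆ {x | 0 ≤ x u} := by
    apply convexHull_min
    · rintro x ⟨S, -, rfl⟩
      exact Set.indicator_nonneg (fun _ _ => (zero_le_one : (0 : ℝ) ≤ 1)) u
    · exact convex_halfSpace_ge (f := fun x : V → ℝ => x u) ⟨fun _ _ => rfl, fun _ _ => rfl⟩ 0
  exact this

/-- Forget the coordinate `u` and glue. -/
def forgetMap {V₁ : Type*} (V₂ : Type*) (u : V₁) :
    ((V₁ → ℝ) × (V₂ → ℝ)) →ₗ[ℝ] ({v : V₁ // v ≠ u} ⊕ V₂ → ℝ) where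
  toFun p := Sum.elim (fun v => p.1 v.1) p.2
  map_add' p q := by ext (i | i) <;> rfl
  map_smul' c p := by ext (i | i) <;> rfl

lemma stab_subst {V₁ V₂ : Type*} [Fintype V₁] [Fintype V₂] [DecidableEq V₁]
    (G₁ : SimpleGraph V₁) (G₂ : SimpleGraph V₂) (u : V₁) :
    stab (substGraph G₁ u G₂) =
      forgetMap V₂ u '' jn (LinearMap.proj u) (stab G₁) (stab G₂) := by
  have hn := stab_nonneg G₁ u
  unfold stab at hn ⊢
  rw [jn_convexHull _ _ _ hn, LinearMap.image_convexHull]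
  congr 1
  ext x
  classical
  constructor
  · rintro ⟨S, hS, rfl⟩
    refine ⟨_, ⟨_, ⟨{v | (∃ h : v ≠ u, Sum.inl ⟨v, h⟩ ∈ S) ∨ (v = u ∧ ∃ w, Sum.inr w ∈ S)}, ?_, rfl⟩,
      _, ⟨{w | Sum.inr w ∈ S}, ?_, rfl⟩, rfl⟩, ?_⟩
    · rintro v (⟨h, hv⟩ | ⟨rfl, w, hw⟩) v' (⟨h', hv'⟩ | ⟨rfl, w', hw'⟩) hadj
      · refine hS _ hv _ hv' ?_
        simp [substGraph, hadj, hadj.ne]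
      · refine hS _ hv _ hw' ?_
        simp [substGraph, hadj.symm]
      · refine hS _ hw _ hv' ?_
        simp [substGraph, hadj]
      · exact hadj.ne rfl
    · intro w hw w' hw' hadj
      refine hS _ hw _ hw' ?_
      simp [substGraph, hadj, hadj.ne]
    · ext (⟨v, h⟩ | w)
      · simp [forgetMap, Set.indicator_apply, h]
      · by_cases hw : Sum.inr w ∈ S
        · have : ∃ w, Sum.inr w ∈ S := ⟨w, hw⟩
          simp [forgetMap, Set.indicator_apply, hw, this]
        · have h0 : ({w | Sum.inr w ∈ S} : Set V₂).indicator (1 : V₂ → ℝ) w = 0 :=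
            Set.indicator_of_notMem (by simpa using hw) _
          simp only [forgetMap, LinearMap.coe_mk, AddHom.coe_mk, Sum.elim_inr, Pi.smul_apply, h0,
            smul_zero]
          exact (Set.indicator_of_notMem hw _).symm
  · rintro ⟨_, ⟨_, ⟨S₁, h1, rfl⟩, _, ⟨S₂, h2, rfl⟩, rfl⟩, rfl⟩
    refine ⟨{z | Sum.elim (fun v : {v : V₁ // v ≠ u} => v.1 ∈ S₁) (fun w => u ∈ S₁ ∧ w ∈ S₂) z},
      ?_, ?_⟩
    · rintro (v | w) hv (v' | w') hv' hadj <;>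
        simp only [Set.mem_ofPred_eq, Sum.elim_inl, Sum.elim_inr] at hv hv' <;>
        simp only [substGraph, SimpleGraph.fromRel_adj] at hadj
      · exact h1 _ hv _ hv' (hadj.2.elim id (fun h => h.symm))
      · exact h1 _ hv'.1 _ hv (hadj.2.elim id id)
      · exact h1 _ hv.1 _ hv' (hadj.2.elim id id)
      · exact h2 _ hv.2 _ hv'.2 (hadj.2.elim id (fun h => h.symm))
    · ext (⟨v, h⟩ | w)
      · by_cases hv : v ∈ S₁ <;> simp [forgetMap, Set.indicator_apply, hv]
      · by_cases hu : u ∈ S₁ <;> by_cases hw : w ∈ S₂ <;>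
          simp [forgetMap, Set.indicator_apply, hu, hw]

/-- if `G = 𝒮(G₁, u, G₂)` is obtained by substituting `G₂` in `G₁` at the
vertex `u`, then `xc (STAB G) ≤ xc (STAB G₁) + xc (STAB G₂)`. -/
theorem xc_stab_subst {V₁ V₂ : Type*} [Fintype V₁] [Fintype V₂] [DecidableEq V₁]
    (G₁ : SimpleGraph V₁) (G₂ : SimpleGraph V₂) (u : V₁) :
    xc (stab (substGraph G₁ u G₂)) ≤ xc (stab G₁) + xc (stab G₂) := by
  obtain ⟨k, Q₁, ⟨hQ₁, π₁, e₁⟩, hs₁⟩ := xc_attained (stab_isPolytope G₁)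
  obtain ⟨l, Q₂, ⟨hQ₂, π₂, e₂⟩, hs₂⟩ := xc_attained (stab_isPolytope G₂)
  rw [← hs₁, ← hs₂]
  set t : (Fin k → ℝ) →ₗ[ℝ] ℝ := (LinearMap.proj u).comp π₁ with htdef
  have ht : ∀ a ∈ Q₁, 0 ≤ t a := by
    intro a ha
    exact stab_nonneg G₁ u _ (e₁ ▸ ⟨a, ha, rfl⟩)
  have n₁ : Q₁.Nonempty := by
    have := stab_nonempty G₁
    rw [← e₁] at this
    exact Set.image_nonempty.1 this
  have n₂ : Q₂.Nonempty := by
    have := stab_nonempty G₂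
    rw [← e₂] at this
    exact Set.image_nonempty.1 this
  refine le_trans (Nat.sInf_le ?_) (polySize_le t ht hQ₁ hQ₂ n₁ n₂)
  refine ⟨k + l, _, ⟨isPolytope_jn t ht hQ₁ hQ₂,
    (forgetMap V₂ u).comp ((π₁.prodMap π₂).comp (glue k l).symm.toLinearMap), ?_⟩, rfl⟩
  rw [stab_subst, ← e₁, ← e₂]
  ext y
  constructor
  · rintro ⟨_, ⟨_, ⟨a, ha, w, hw, rfl⟩, rfl⟩, rfl⟩
    exact ⟨_, ⟨π₁ a, ⟨a, ha, rfl⟩, π₂ w, ⟨w, hw, rfl⟩, rfl⟩, by simp [htdef]⟩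
  · rintro ⟨_, ⟨_, ⟨a, ha, rfl⟩, _, ⟨w, hw, rfl⟩, rfl⟩, rfl⟩
    exact ⟨_, ⟨_, ⟨a, ha, w, hw, rfl⟩, rfl⟩, by simp [htdef]⟩
end

section
/- Let G = (V,E) be a perfect graph admitting a skew partition (A₁, B₁, A₂, B₂) of V. Then xc(STAB(G)) ≤ 2·xc(STAB(G[A₁ ∪ B₁])) + 2·xc(STAB(G[A₂ ∪ B₂])) + xc(STAB(G[A₁ ∪ B₂])) + xc(STAB(G[A₂ ∪ B₁])). -/
/-- The clique number of a graph. -/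
noncomputable def cliqueNum {V : Type*} (G : SimpleGraph V) : ℕ :=
  sSup {n : ℕ | ∃ s : Finset V, G.IsNClique n s}

/-- A graph is perfect if every induced subgraph has chromatic number equal to its
clique number. -/
def IsPerfect {V : Type*} (G : SimpleGraph V) : Prop :=
  ∀ S : Set V, (G.induce S).chromaticNumber = (cliqueNum (G.induce S) : ℕ∞)

/-- A 2-join of `G` with parts `(V₁, V₂)`: there are disjoint nonempty `Aₖ, Bₖ ⊆ Vₖ` such
that every vertex of `A₁` is adjacent to every vertex of `A₂`, every vertex of `B₁` is
adjacent to every vertex of `B₂`, and there are no other edges between `V₁` and `V₂`. -/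
def Is2Join {V : Type*} (G : SimpleGraph V) (V₁ V₂ : Set V) : Prop :=
  V₁ ∪ V₂ = Set.univ ∧ Disjoint V₁ V₂ ∧
  ∃ A₁ B₁ A₂ B₂ : Set V, A₁ ⊆ V₁ ∧ B₁ ⊆ V₁ ∧ A₂ ⊆ V₂ ∧ B₂ ⊆ V₂ ∧
    A₁.Nonempty ∧ B₁.Nonempty ∧ A₂.Nonempty ∧ B₂.Nonempty ∧
    Disjoint A₁ B₁ ∧ Disjoint A₂ B₂ ∧
    (∀ a₁ ∈ A₁, ∀ a₂ ∈ A₂, G.Adj a₁ a₂) ∧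
    (∀ b₁ ∈ B₁, ∀ b₂ ∈ B₂, G.Adj b₁ b₂) ∧
    (∀ v₁ ∈ V₁, ∀ v₂ ∈ V₂, G.Adj v₁ v₂ →
      (v₁ ∈ A₁ ∧ v₂ ∈ A₂) ∨ (v₁ ∈ B₁ ∧ v₂ ∈ B₂))

/-- A skew partition of `G`: a partition of the vertices into nonempty sets
`(A₁, B₁, A₂, B₂)` with all edges present between `A₁` and `A₂` and no edges between
`B₁` and `B₂`. -/
def IsSkewPartition {V : Type*} (G : SimpleGraph V) (A₁ B₁ A₂ B₂ : Set V) : Prop :=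
  A₁.Nonempty ∧ B₁.Nonempty ∧ A₂.Nonempty ∧ B₂.Nonempty ∧
  A₁ ∪ B₁ ∪ A₂ ∪ B₂ = Set.univ ∧
  Disjoint A₁ B₁ ∧ Disjoint A₁ A₂ ∧ Disjoint A₁ B₂ ∧
  Disjoint B₁ A₂ ∧ Disjoint B₁ B₂ ∧ Disjoint A₂ B₂ ∧
  (∀ a₁ ∈ A₁, ∀ a₂ ∈ A₂, G.Adj a₁ a₂) ∧
  (∀ b₁ ∈ B₁, ∀ b₂ ∈ B₂, ¬ G.Adj b₁ b₂)


open Classical in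
lemma SK_cover {V : Type*} [Fintype V] (G : SimpleGraph V) (hG : IsPerfect G) :
    ∀ (N : ℕ) (w : V → ℕ), ∑ v, w v = N → ∀ k : ℕ,
      (∀ K : Finset V, G.IsClique (K : Set V) → ∑ v ∈ K, w v ≤ k) →
      ∃ S : Fin k → Set V, (∀ i, ∀ u ∈ S i, ∀ v ∈ S i, ¬ G.Adj u v) ∧
        ∀ v, w v = ∑ i, if v ∈ S i then 1 else 0 := by
  intro N
  induction N using Nat.strong_induction_on with
  | _ N ih =>
  intro w hw k hk
  by_cases hall : ∀ v, w v ≤ 1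
  · set T : Set V := {v | w v = 1} with hT
    have hcl : cliqueNum (G.induce T) ≤ k := by
      apply csSup_le'
      rintro n ⟨s, hs⟩
      have h1 := hk (s.map (Function.Embedding.subtype _)) (by
        have := hs.1
        intro a ha b hb hab
        simp only [Finset.coe_map, Set.mem_image] at ha hb
        obtain ⟨a, ha, rfl⟩ := ha
        obtain ⟨b, hb, rfl⟩ := hb
        exact this ha hb (fun h => hab (by rw [h])))
      rw [Finset.sum_map] at h1
      have h2 : ∑ v ∈ s, w ((Function.Embedding.subtype (· ∈ T)) v) = ∑ v ∈ s, 1 :=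
        Finset.sum_congr rfl (fun v _ => v.2)
      have h3 : s.card ≤ k := by
        rw [Finset.card_eq_sum_ones]; exact h2 ▸ h1
      exact hs.2 ▸ h3
    have hcol : (G.induce T).Colorable k := by
      rw [← SimpleGraph.chromaticNumber_le_iff_colorable, hG T]
      exact_mod_cast hcl
    obtain ⟨C⟩ := hcol
    refine ⟨fun i => {v | ∃ h : v ∈ T, C ⟨v, h⟩ = i}, ?_, ?_⟩
    · rintro i u ⟨hu, hui⟩ v ⟨hv, hvi⟩ hadj
      exact C.valid (v := ⟨u, hu⟩) (w := ⟨v, hv⟩) hadj (hui.trans hvi.symm)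
    · intro v
      by_cases hv : v ∈ T
      · have : ∀ i, (v ∈ {v | ∃ h : v ∈ T, C ⟨v, h⟩ = i}) ↔ C ⟨v, hv⟩ = i := by
          intro i; constructor
          · rintro ⟨_, h⟩; exact h
          · intro h; exact ⟨hv, h⟩
        simp only [this]
        simp only [Finset.sum_ite_eq, Finset.mem_univ, if_true]
        exact hv
      · have h0 : w v = 0 := by
          have := hall v
          have h1 : w v ≠ 1 := hv
          omega
        rw [h0, eq_comm]
        apply Finset.sum_eq_zero
        intro i _
        rw [if_neg]
        rintro ⟨h, _⟩; exact hv h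
  · push Not at hall
    obtain ⟨x, hx⟩ := hall
    set w' : V → ℕ := fun v => if v = x then w v - 1 else w v with hw'
    have hle : ∀ v, w' v ≤ w v := by intro v; simp only [hw']; split_ifs <;> omega
    have hlt : ∑ v, w' v < ∑ v, w v := by
      apply Finset.sum_lt_sum (fun v _ => hle v)
      refine ⟨x, Finset.mem_univ _, ?_⟩
      simp only [hw', if_true]; omega
    obtain ⟨S', hS', hc'⟩ := ih _ (hw ▸ hlt) w' rfl k (fun K hK =>
      (Finset.sum_le_sum (fun v _ => hle v)).trans (hk K hK))
    have hex : ∃ i, x ∈ S' i := by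
      by_contra hno
      push Not at hno
      have h1 := hc' x
      simp only [hno, if_false, Finset.sum_const_zero] at h1
      simp only [hw', if_true] at h1
      omega
    obtain ⟨i0, hi0⟩ := hex
    obtain ⟨k, rfl⟩ : ∃ k', k = k' + 1 := ⟨k - 1, by have := i0.2; omega⟩
    set X := S' i0 with hX
    have hXpos : ∀ v ∈ X, 1 ≤ w v := by
      intro v hv
      refine le_trans ?_ (hle v)
      rw [hc' v]
      calc 1 = (if v ∈ S' i0 then 1 else 0) := by rw [if_pos hv]
        _ ≤ _ := Finset.single_le_sum (f := fun i => if v ∈ S' i then 1 else 0)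
            (fun i _ => Nat.zero_le _) (Finset.mem_univ i0)
    set w'' : V → ℕ := fun v => w v - (if v ∈ X then 1 else 0) with hw''
    have hsplit : ∀ v, w v = (if v ∈ X then 1 else 0) + w'' v := by
      intro v
      simp only [hw'']
      by_cases hv : v ∈ X
      · have := hXpos v hv
        simp only [hv, if_true]; omega
      · simp only [hv, if_false]; omega
    have hlt2 : ∑ v, w'' v < ∑ v, w v := by
      apply Finset.sum_lt_sum (fun v _ => by rw [hsplit v]; omega)
      refine ⟨x, Finset.mem_univ _, ?_⟩
      rw [hsplit x, if_pos hi0]; omega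
    obtain ⟨S'', hS'', hc''⟩ := ih _ (hw ▸ hlt2) w'' rfl k (by
      intro K hK
      have h1 := hk K hK
      have h2 : ∑ v ∈ K, w v = ∑ v ∈ K, (if v ∈ X then 1 else 0) + ∑ v ∈ K, w'' v := by
        rw [← Finset.sum_add_distrib]
        exact Finset.sum_congr rfl (fun v _ => hsplit v)
      by_cases hKX : ∃ v ∈ K, v ∈ X
      · obtain ⟨v, hvK, hvX⟩ := hKX
        have h3 : 1 ≤ ∑ v ∈ K, (if v ∈ X then 1 else 0) := by
          calc 1 = (if v ∈ X then 1 else 0) := by rw [if_pos hvX]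
            _ ≤ _ := Finset.single_le_sum (f := fun v => if v ∈ X then 1 else 0)
              (fun i _ => Nat.zero_le _) hvK
        omega
      · push Not at hKX
        have h4 : ∑ v ∈ K, w'' v = ∑ v ∈ K, w' v := by
          apply Finset.sum_congr rfl
          intro v hv
          have hvx : v ≠ x := by rintro rfl; exact hKX _ hv hi0
          simp only [hw'', hw', hKX v hv, hvx, if_false]; rfl
        rw [h4]
        have h5 : ∑ v ∈ K, w' v = ∑ i, ∑ v ∈ K, (if v ∈ S' i then 1 else 0) := by
          rw [Finset.sum_comm]
          exact Finset.sum_congr rfl (fun v _ => hc' v)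
        rw [h5]
        have h6 : ∀ i, ∑ v ∈ K, (if v ∈ S' i then 1 else 0) ≤ (if i = i0 then 0 else 1) := by
          intro i
          by_cases hi : i = i0
          · subst hi
            rw [if_pos rfl, Finset.sum_eq_zero]
            intro v hv
            rw [if_neg (hKX v hv)]
          · rw [if_neg hi, ← Finset.card_filter, Finset.card_le_one]
            intro a ha b hb
            rw [Finset.mem_filter] at ha hb
            by_contra hab
            exact hS' i a ha.2 b hb.2 (hK ha.1 hb.1 hab)
        refine (Finset.sum_le_sum (fun i _ => h6 i)).trans ?_
        have h7 : ∑ i : Fin (k+1), (if i = i0 then 0 else 1) + ∑ i : Fin (k+1), (if i = i0 then 1 else 0) = k + 1 := by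
          rw [← Finset.sum_add_distrib]
          have : ∀ i : Fin (k+1), (if i = i0 then 0 else 1) + (if i = i0 then 1 else 0) = 1 := by
            intro i; split_ifs <;> rfl
          simp only [this]; simp
        simp only [Finset.sum_ite_eq', Finset.mem_univ, if_true] at h7
        omega)
    refine ⟨Fin.cons X S'', ?_, ?_⟩
    · intro i
      refine Fin.cases ?_ ?_ i
      · simpa using hS' i0
      · intro j; simpa using hS'' j
    · intro v
      rw [Fin.sum_univ_succ, hsplit v, hc'' v]
      simp

lemma SK_stab_finite {V : Type*} [Fintype V] (G : SimpleGraph V) :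
    {x : V → ℝ | ∃ S : Set V, (∀ u ∈ S, ∀ v ∈ S, ¬ G.Adj u v) ∧ x = S.indicator 1}.Finite := by
  apply (Set.finite_range (fun S : Set V => (S.indicator 1 : V → ℝ))).subset
  rintro x ⟨S, _, rfl⟩
  exact ⟨S, rfl⟩

open Classical in
lemma SK_mem_stab {V : Type*} [Fintype V] (G : SimpleGraph V) (hG : IsPerfect G)
    (x : V → ℝ) (h0 : ∀ v, 0 ≤ x v)
    (h1 : ∀ K : Finset V, G.IsClique (K : Set V) → ∑ v ∈ K, x v ≤ 1) : x ∈ stab G := by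
  have hclosed : IsClosed (stab G) := (SK_stab_finite G).isClosed_convexHull (𝕜 := ℝ)
  have hlim : Filter.Tendsto (fun N : ℕ => fun v => (⌊x v * (N : ℝ)⌋₊ : ℝ) / (N : ℝ))
      Filter.atTop (nhds x) := by
    rw [tendsto_pi_nhds]
    intro v
    exact (tendsto_nat_floor_mul_div_atTop (h0 v)).comp tendsto_natCast_atTop_atTop
  refine hclosed.mem_of_tendsto hlim ?_
  filter_upwards [Filter.eventually_gt_atTop 0] with N hN
  have hN' : (0 : ℝ) < N := by exact_mod_cast hN
  obtain ⟨S, hS, hc⟩ := SK_cover G hG _ (fun v => ⌊x v * (N : ℝ)⌋₊) rfl N (by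
    intro K hK
    have : ((∑ v ∈ K, ⌊x v * (N : ℝ)⌋₊ : ℕ) : ℝ) ≤ N := by
      push_cast
      calc ∑ v ∈ K, (⌊x v * (N : ℝ)⌋₊ : ℝ) ≤ ∑ v ∈ K, x v * N :=
            Finset.sum_le_sum (fun v _ => Nat.floor_le (mul_nonneg (h0 v) hN'.le))
        _ = (∑ v ∈ K, x v) * N := by rw [Finset.sum_mul]
        _ ≤ 1 * N := by gcongr; exact h1 K hK
        _ = N := one_mul _
    exact_mod_cast this)
  have heq : (fun v => (⌊x v * (N : ℝ)⌋₊ : ℝ) / (N : ℝ)) =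
      ∑ i : Fin N, (1 / (N : ℝ)) • ((S i).indicator 1 : V → ℝ) := by
    ext v
    rw [hc v]
    push_cast
    simp only [Finset.sum_apply, Pi.smul_apply, smul_eq_mul, Set.indicator_apply, Pi.one_apply]
    rw [← Finset.mul_sum]
    ring
  rw [heq]
  apply (convex_convexHull ℝ _).sum_mem
  · intro i _; positivity
  · simp; field_simp
  · intro i _
    exact subset_convexHull ℝ _ ⟨S i, hS i, rfl⟩

open Classical in
lemma SK_stab_sub {V : Type*} [Fintype V] (G : SimpleGraph V)
    (x : V → ℝ) (hx : x ∈ stab G) : (∀ v, 0 ≤ x v) ∧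
     ∀ K : Finset V, G.IsClique (K : Set V) → ∑ v ∈ K, x v ≤ 1 := by
  have : stab G ⊆ {x : V → ℝ | (∀ v, 0 ≤ x v) ∧
     ∀ K : Finset V, G.IsClique (K : Set V) → ∑ v ∈ K, x v ≤ 1} := by
    apply convexHull_min
    · rintro _ ⟨S, hS, rfl⟩
      refine ⟨fun v => Set.indicator_nonneg (by simp) v, ?_⟩
      intro K hK
      simp only [Set.indicator_apply, Pi.one_apply]
      rw [← Finset.sum_filter, Finset.sum_const, nsmul_eq_mul, mul_one]
      have : (K.filter (· ∈ S)).card ≤ 1 := by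
        rw [Finset.card_le_one]
        intro a ha b hb
        rw [Finset.mem_filter] at ha hb
        by_contra hab
        exact hS a ha.2 b hb.2 (hK ha.1 hb.1 hab)
      exact_mod_cast this
    · rintro a ⟨ha, ha'⟩ b ⟨hb, hb'⟩ s t hs ht hst
      refine ⟨fun v => ?_, fun K hK => ?_⟩
      · simp only [Pi.add_apply, Pi.smul_apply, smul_eq_mul]
        have := ha v; have := hb v; positivity
      · simp only [Pi.add_apply, Pi.smul_apply, smul_eq_mul, Finset.sum_add_distrib,
          ← Finset.mul_sum]
        nlinarith [ha' K hK, hb' K hK]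
  exact this hx

section poly
variable {κ σ : Type*} [Fintype κ] [Fintype σ]

lemma SK_ext (A : Set (κ → ℝ)) (hA : ∀ x ∈ A, ∀ y ∈ A, ∀ ε : ℝ, y + ε • (y - x) ∈ A)
    (s : σ → (κ → ℝ) →ₗ[ℝ] ℝ) (x y : κ → ℝ) (hx : x ∈ A) (hy : y ∈ A)
    (hy0 : ∀ i, 0 ≤ s i y)
    (h : ∀ i, s i y = 0 → s i x = 0) :
    ∃ ε : ℝ, 0 < ε ∧ y + ε • (y - x) ∈ {z | z ∈ A ∧ ∀ i, 0 ≤ s i z} := by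
  have hT : ∀ T : Finset σ, ∃ ε : ℝ, 0 < ε ∧ ∀ i ∈ T, ε * (s i x - s i y) ≤ s i y := by
    classical
    intro T
    induction T using Finset.induction_on with
    | empty => exact ⟨1, one_pos, by simp⟩
    | insert j T hj ih =>
      obtain ⟨ε, hε, hT⟩ := ih
      by_cases hj0 : s j y = 0
      · refine ⟨ε, hε, ?_⟩
        intro i hi
        rcases Finset.mem_insert.1 hi with rfl | hi
        · rw [h _ hj0, hj0]; simp
        · exact hT i hi
      · have hpos : 0 < s j y := lt_of_le_of_ne (hy0 j) (Ne.symm hj0)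
        set δ := s j y / (|s j x - s j y| + 1) with hδ
        have hδ0 : 0 < δ := by positivity
        refine ⟨min ε δ, lt_min hε hδ0, ?_⟩
        intro i hi
        have hm0 : 0 < min ε δ := lt_min hε hδ0
        rcases Finset.mem_insert.1 hi with rfl | hi
        · calc min ε δ * (s i x - s i y) ≤ min ε δ * (|s i x - s i y| + 1) := by
                gcongr; have := le_abs_self (s i x - s i y); linarith
            _ ≤ δ * (|s i x - s i y| + 1) := by gcongr; exact min_le_right _ _
            _ = s i y := by rw [hδ]; field_simp
        · by_cases hs : 0 ≤ s i x - s i y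
          · exact (mul_le_mul_of_nonneg_right (min_le_left _ _) hs).trans (hT i hi)
          · push Not at hs
            have := hy0 i
            nlinarith
  obtain ⟨ε, hε, hT⟩ := hT Finset.univ
  refine ⟨ε, hε, hA x hx y hy ε, fun i => ?_⟩
  have := hT i (Finset.mem_univ i)
  rw [map_add, map_smul, map_sub, smul_eq_mul]
  linarith

lemma SK_facet (A : Set (κ → ℝ)) (hA : ∀ x ∈ A, ∀ y ∈ A, ∀ ε : ℝ, y + ε • (y - x) ∈ A)
    (s : σ → (κ → ℝ) →ₗ[ℝ] ℝ) (F : Set (κ → ℝ)) (hconv : Convex ℝ {z | z ∈ A ∧ ∀ i, 0 ≤ s i z})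
    (hF : IsFacet {z | z ∈ A ∧ ∀ i, 0 ≤ s i z} F) :
    ∃ i, F = {z | (z ∈ A ∧ ∀ i, 0 ≤ s i z) ∧ s i z = 0} := by
  classical
  set Q : Set (κ → ℝ) := {z | z ∈ A ∧ ∀ i, 0 ≤ s i z} with hQ
  obtain ⟨⟨hFQ, c, α, hc, hFeq⟩, hne, hFne, hmax⟩ := hF
  by_cases hcase : ∃ i, (∀ y ∈ F, s i y = 0) ∧ ∃ x ∈ Q, s i x ≠ 0
  · obtain ⟨i, hi, x, hx, hxi⟩ := hcase
    refine ⟨i, ?_⟩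
    symm
    have hsub : F ⊆ {z | (z ∈ A ∧ ∀ i, 0 ≤ s i z) ∧ s i z = 0} :=
      fun y hy => ⟨hFQ hy, hi y hy⟩
    apply hmax _ _ (hne.mono hsub) _ hsub
    · have hrep : ∀ y : κ → ℝ, ∑ j, (- s i (Pi.single j 1)) * y j = - s i y := by
        intro y
        conv_rhs => rw [← Finset.univ_sum_single y, map_sum]
        rw [← Finset.sum_neg_distrib]
        apply Finset.sum_congr rfl
        intro j _
        have : (Pi.single j (y j) : κ → ℝ) = y j • Pi.single j 1 := by
          rw [← Pi.single_smul]; simp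
        rw [this, map_smul, smul_eq_mul]; ring
      refine ⟨fun y hy => hy.1, fun j => - s i (Pi.single j 1), 0, ?_, ?_⟩
      · intro y hy
        rw [hrep]
        have := hy.2 i
        linarith
      · ext y
        simp only [Set.mem_ofPred_eq, hrep, neg_eq_zero, hQ]
    · intro heq
      have : x ∈ {z | (z ∈ A ∧ ∀ i, 0 ≤ s i z) ∧ s i z = 0} := heq ▸ hx
      exact hxi this.2
  · exfalso
    push Not at hcase
    have hT : ∀ T : Finset σ, ∃ y ∈ F, ∀ i ∈ T, s i y = 0 → ∀ x ∈ Q, s i x = 0 := by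
      intro T
      induction T using Finset.induction_on with
      | empty => obtain ⟨y, hy⟩ := hne; exact ⟨y, hy, by simp⟩
      | insert j T hj ih =>
        obtain ⟨y, hy, hyT⟩ := ih
        by_cases hj0 : ∀ y ∈ F, s j y = 0
        · refine ⟨y, hy, ?_⟩
          intro i hi
          rcases Finset.mem_insert.1 hi with rfl | hi
          · intro _; exact hcase _ hj0
          · exact hyT i hi
        · push Not at hj0
          obtain ⟨u, hu, hu0⟩ := hj0
          have hval : ∀ i, s i ((1/2 : ℝ) • y + (1/2 : ℝ) • u) = (s i y + s i u) / 2 := by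
            intro i
            rw [map_add, map_smul, map_smul, smul_eq_mul, smul_eq_mul]; ring
          refine ⟨(1/2 : ℝ) • y + (1/2 : ℝ) • u, ?_, ?_⟩
          · rw [hFeq] at hy hu ⊢
            refine ⟨hconv hy.1 hu.1 (by norm_num) (by norm_num) (by norm_num), ?_⟩
            have : ∑ i, c i * ((1/2 : ℝ) • y + (1/2 : ℝ) • u) i
                = (1/2) * ∑ i, c i * y i + (1/2) * ∑ i, c i * u i := by
              rw [Finset.mul_sum, Finset.mul_sum, ← Finset.sum_add_distrib]
              apply Finset.sum_congr rfl
              intro i _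
              simp only [Pi.add_apply, Pi.smul_apply, smul_eq_mul]; ring
            rw [this, hy.2, hu.2]; ring
          · intro i hi h0
            rw [hval] at h0
            have h1 := (hFQ hy).2 i
            have h2 := (hFQ hu).2 i
            rcases Finset.mem_insert.1 hi with rfl | hi
            · exfalso; apply hu0; linarith
            · exact hyT i hi (by linarith)
    obtain ⟨y, hy, hyT⟩ := hT Finset.univ
    apply hFne
    apply Set.Subset.antisymm hFQ
    intro x hx
    obtain ⟨ε, hε, hmem⟩ := SK_ext A hA s x y hx.1 (hFQ hy).1 (hFQ hy).2
      (fun i h => hyT i (Finset.mem_univ i) h x hx)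
    have h1 := hc _ hmem
    have h2 : ∑ i, c i * (y + ε • (y - x)) i
        = ∑ i, c i * y i + ε * (∑ i, c i * y i - ∑ i, c i * x i) := by
      rw [← Finset.sum_sub_distrib, Finset.mul_sum, ← Finset.sum_add_distrib]
      apply Finset.sum_congr rfl
      intro i _
      simp only [Pi.add_apply, Pi.smul_apply, Pi.sub_apply, smul_eq_mul]; ring
    have h3 := hc x hx
    rw [hFeq] at hy ⊢
    refine ⟨hx, ?_⟩
    rw [h2, hy.2] at h1
    by_contra hne'
    have h4 : 0 < α - ∑ i, c i * x i := by
      have := lt_of_le_of_ne h3 hne'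
      linarith
    have := mul_pos hε h4
    linarith

lemma SK_size (A : Set (κ → ℝ)) (hA : ∀ x ∈ A, ∀ y ∈ A, ∀ ε : ℝ, y + ε • (y - x) ∈ A)
    (s : σ → (κ → ℝ) →ₗ[ℝ] ℝ) (hconv : Convex ℝ {z | z ∈ A ∧ ∀ i, 0 ≤ s i z}) :
    polySize {z | z ∈ A ∧ ∀ i, 0 ≤ s i z} ≤ Fintype.card σ := by
  unfold polySize
  refine (Set.ncard_le_ncard (t := Set.range
    (fun i : σ => {z | (z ∈ A ∧ ∀ i, 0 ≤ s i z) ∧ s i z = 0})) ?_ (Set.finite_range _)).trans ?_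
  · intro F hF
    obtain ⟨i, hi⟩ := SK_facet A hA s F hconv hF
    exact ⟨i, hi.symm⟩
  · rw [← Set.image_univ]
    refine (Set.ncard_image_le Set.finite_univ).trans ?_
    rw [Set.ncard_univ, Nat.card_eq_fintype_card]

lemma SK_polytope (A : Set (κ → ℝ)) (hA : ∀ x ∈ A, ∀ y ∈ A, ∀ ε : ℝ, y + ε • (y - x) ∈ A)
    (s : σ → (κ → ℝ) →ₗ[ℝ] ℝ) (hconv : Convex ℝ {z | z ∈ A ∧ ∀ i, 0 ≤ s i z})
    (hcomp : IsCompact {z | z ∈ A ∧ ∀ i, 0 ≤ s i z}) :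
    IsPolytope {z | z ∈ A ∧ ∀ i, 0 ≤ s i z} := by
  set Q : Set (κ → ℝ) := {z | z ∈ A ∧ ∀ i, 0 ≤ s i z} with hQ
  have hfin : (Q.extremePoints ℝ).Finite := by
    apply Set.Finite.of_finite_image (f := fun z => {i | s i z = 0}) (Set.toFinite _)
    intro x hx y hy hxy
    have hxy' : ∀ i, s i y = 0 → s i x = 0 := by
      intro i hi
      have : i ∈ {i | s i x = 0} := by
        simp only at hxy
        rw [hxy]; exact hi
      exact this
    obtain ⟨ε, hε, hmem⟩ := SK_ext A hA s x y hx.1.1 hy.1.1 hy.1.2 hxy'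
    have hop : y ∈ openSegment ℝ x (y + ε • (y - x)) := by
      refine ⟨ε / (1 + ε), 1 / (1 + ε), by positivity, by positivity, by field_simp; ring, ?_⟩
      ext j
      simp only [Pi.add_apply, Pi.smul_apply, Pi.sub_apply, smul_eq_mul]
      field_simp
      ring
    exact hy.2 hx.1 hmem hop
  refine ⟨_, hfin, ?_⟩
  have h := closure_convexHull_extremePoints hcomp hconv
  rw [(hfin.isClosed_convexHull (𝕜 := ℝ)).closure_eq] at h
  exact h.symm
end poly

/-- slack form -/
def SKSF {ι : Type*} [Fintype ι] (P : Set (ι → ℝ)) (σ : Type) [Fintype σ] : Prop :=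
  ∃ (W : Submodule ℝ ((ι → ℝ) × (σ → ℝ) × ℝ)) (R : ℝ), 0 < R ∧
    (∀ x, x ∈ P ↔ ∃ s : σ → ℝ, (∀ i, 0 ≤ s i) ∧ (x, s, (1 : ℝ)) ∈ W) ∧
    ∀ x s t, (∀ i, 0 ≤ s i) → (x, s, t) ∈ W → ‖x‖ ≤ R * t ∧ ‖s‖ ≤ R * t

lemma SK_xc_le {ι : Type*} [Fintype ι] (P : Set (ι → ℝ)) (σ : Type) [Fintype σ]
    (h : SKSF P σ) : xc P ≤ Fintype.card σ := by
  obtain ⟨W, R, hR, hP, hb⟩ := h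
  let e : (Fin (Module.finrank ℝ ((ι → ℝ) × (σ → ℝ))) → ℝ) ≃ₗ[ℝ] ((ι → ℝ) × (σ → ℝ)) :=
    LinearEquiv.ofFinrankEq _ _ (by simp)
  set s : σ → (Fin (Module.finrank ℝ ((ι → ℝ) × (σ → ℝ))) → ℝ) →ₗ[ℝ] ℝ := fun i =>
    (LinearMap.proj i ∘ₗ LinearMap.snd ℝ _ _) ∘ₗ e.toLinearMap with hs
  have hsv : ∀ i z, s i z = (e z).2 i := fun i z => rfl
  set A : Set (Fin (Module.finrank ℝ ((ι → ℝ) × (σ → ℝ))) → ℝ) :=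
    {z | ((e z).1, (e z).2, (1 : ℝ)) ∈ W} with hAdef
  have hA : ∀ x ∈ A, ∀ y ∈ A, ∀ ε : ℝ, y + ε • (y - x) ∈ A := by
    intro x hx y hy ε
    have := W.add_mem hy (W.smul_mem ε (W.sub_mem hy hx))
    simp only [hAdef, Set.mem_ofPred_eq, map_add, map_smul, map_sub]
    convert this using 1
    ext <;> simp
  have hconv : Convex ℝ {z | z ∈ A ∧ ∀ i, 0 ≤ s i z} := by
    rintro x ⟨hx, hx'⟩ y ⟨hy, hy'⟩ a b ha hb hab
    refine ⟨?_, fun i => ?_⟩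
    · have := W.add_mem (W.smul_mem a hx) (W.smul_mem b hy)
      simp only [hAdef, Set.mem_ofPred_eq, map_add, map_smul]
      convert this using 1
      ext <;> simp [hab]
    · rw [map_add, map_smul, map_smul, smul_eq_mul, smul_eq_mul]
      have := hx' i; have := hy' i
      positivity
  have hcont : Continuous e := e.toLinearMap.continuous_of_finiteDimensional
  have hcont' : Continuous e.symm := e.symm.toLinearMap.continuous_of_finiteDimensional
  have hcomp : IsCompact {z | z ∈ A ∧ ∀ i, 0 ≤ s i z} := by
    have hcl : IsClosed {z | z ∈ A ∧ ∀ i, 0 ≤ s i z} := by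
      apply IsClosed.inter
      · have : IsClosed (W : Set ((ι → ℝ) × (σ → ℝ) × ℝ)) := W.closed_of_finiteDimensional
        exact this.preimage (f := fun z => ((e z).1, (e z).2, (1 : ℝ))) (by fun_prop)
      · have : {z | ∀ i, 0 ≤ s i z} = ⋂ i, {z | 0 ≤ s i z} := by ext; simp
        change IsClosed {z | ∀ i, 0 ≤ s i z}
        rw [this]
        refine isClosed_iInter (fun i => ?_)
        exact isClosed_le continuous_const (s i).continuous_of_finiteDimensional
    have hK : IsCompact (e.symm '' (Metric.closedBall (0 : (ι → ℝ) × (σ → ℝ)) R)) :=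
      (isCompact_closedBall _ _).image hcont'
    apply hK.of_isClosed_subset hcl
    rintro z ⟨hz, hz'⟩
    refine ⟨e z, ?_, by simp⟩
    have := hb _ _ _ (fun i => hz' i) hz
    rw [mul_one] at this
    rw [mem_closedBall_zero_iff, Prod.norm_def]
    exact max_le this.1 this.2
  have hpoly := SK_polytope A hA s hconv hcomp
  refine le_trans (Nat.sInf_le ⟨_, _, ⟨hpoly, LinearMap.fst ℝ _ _ ∘ₗ e.toLinearMap, ?_⟩, rfl⟩)
    (SK_size A hA s hconv)
  ext x
  rw [hP]
  constructor
  · rintro ⟨z, ⟨hz, hz'⟩, rfl⟩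
    exact ⟨(e z).2, fun i => hz' i, hz⟩
  · rintro ⟨t, ht, htW⟩
    refine ⟨e.symm (x, t), ⟨?_, ?_⟩, by simp⟩
    · simpa [hAdef] using htW
    · intro i; rw [hsv]; simpa using ht i

lemma SK_dot {κ : Type*} [Fintype κ] (f : (κ → ℝ) →ₗ[ℝ] ℝ) :
    ∃ c : κ → ℝ, ∀ y, ∑ j, c j * y j = f y := by
  classical
  refine ⟨fun j => f (Pi.single j 1), fun y => ?_⟩
  conv_rhs => rw [← Finset.univ_sum_single y, map_sum]
  apply Finset.sum_congr rfl
  intro j _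
  have : (Pi.single j (y j) : κ → ℝ) = y j • Pi.single j 1 := by
    rw [← Pi.single_smul]; simp
  rw [this, map_smul, smul_eq_mul]; ring

/-- the linear functional with coefficients `c` -/
def SKlin {κ : Type*} [Fintype κ] (c : κ → ℝ) : (κ → ℝ) →ₗ[ℝ] ℝ where
  toFun y := ∑ i, c i * y i
  map_add' x y := by
    simp only [Pi.add_apply, mul_add, Finset.sum_add_distrib]
  map_smul' a x := by
    simp only [Pi.smul_apply, smul_eq_mul, RingHom.id_apply, Finset.mul_sum]
    exact Finset.sum_congr rfl (fun i _ => by ring)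

lemma SK_faces_finite {κ : Type*} [Fintype κ] (F : Set (κ → ℝ)) (hF : F.Finite) :
    {G : Set (κ → ℝ) | IsExposedFace (convexHull ℝ F) G}.Finite := by
  apply Set.Finite.of_finite_image (f := fun G => G ∩ F)
  · apply (hF.finite_subsets).subset
    rintro _ ⟨G, _, rfl⟩
    exact Set.inter_subset_right
  · have key : ∀ G₁ G₂ : Set (κ → ℝ), IsExposedFace (convexHull ℝ F) G₁ →
        IsExposedFace (convexHull ℝ F) G₂ → G₁ ∩ F = G₂ ∩ F → G₁ ⊆ G₂ := by
      rintro G₁ G₂ ⟨hs₁, c₁, α₁, hc₁, hG₁⟩ ⟨hs₂, c₂, α₂, hc₂, hG₂⟩ heq x hx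
      have hxF : x ∈ convexHull ℝ F := hs₁ hx
      have hx1 : SKlin c₁ x = α₁ := by rw [hG₁] at hx; exact hx.2
      obtain ⟨T, rfl⟩ : ∃ T : Finset (κ → ℝ), (T : Set _) = F := ⟨hF.toFinset, by simp⟩
      have hxF' := hxF
      rw [Finset.mem_convexHull'] at hxF'
      obtain ⟨w, hw0, hw1, hwx⟩ := hxF'
      have hpos : ∀ v ∈ T, w v ≠ 0 → SKlin c₁ v = α₁ := by
        have hsum : ∑ v ∈ T, w v * (α₁ - SKlin c₁ v) = 0 := by
          have : ∑ v ∈ T, w v * SKlin c₁ v = α₁ := by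
            rw [← hx1, ← hwx, map_sum]
            simp
          simp only [mul_sub, Finset.sum_sub_distrib, ← Finset.sum_mul, hw1, this]; ring
        rw [Finset.sum_eq_zero_iff_of_nonneg] at hsum
        · intro v hv hwv
          have := hsum v hv
          rcases mul_eq_zero.1 this with h | h
          · exact absurd h hwv
          · linarith
        · intro v hv
          have : SKlin c₁ v ≤ α₁ := hc₁ v (subset_convexHull ℝ _ hv)
          exact mul_nonneg (hw0 v hv) (by linarith)
      have hpos2 : ∀ v ∈ T, w v * SKlin c₂ v = w v * α₂ := by
        intro v hv
        by_cases hwv : w v = 0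
        · simp [hwv]
        · have h1 : v ∈ G₁ ∩ (T : Set _) := by
            refine ⟨?_, hv⟩
            rw [hG₁]; exact ⟨subset_convexHull ℝ _ hv, hpos v hv hwv⟩
          rw [heq, hG₂] at h1
          have : SKlin c₂ v = α₂ := h1.1.2
          rw [this]
      rw [hG₂]
      refine ⟨hxF, ?_⟩
      change SKlin c₂ x = α₂
      rw [← hwx, map_sum]
      simp only [map_smul, smul_eq_mul]
      rw [Finset.sum_congr rfl hpos2, ← Finset.sum_mul, hw1, one_mul]
    intro G₁ h₁ G₂ h₂ heq
    exact Set.Subset.antisymm (key _ _ h₁ h₂ heq) (key _ _ h₂ h₁ heq.symm)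

lemma SK_rep {κ : Type*} [Fintype κ] (F : Set (κ → ℝ)) (hF : F.Finite) (hne : F.Nonempty)
    (y : κ → ℝ) (hy : (y, (1 : ℝ)) ∈ Submodule.span ℝ
      ((fun q : κ → ℝ => (q, (1 : ℝ))) '' (convexHull ℝ F)))
    (hyQ : y ∉ convexHull ℝ F) :
    ∃ G, IsFacet (convexHull ℝ F) G ∧ ∀ (c : κ → ℝ) (α : ℝ),
      (∀ y ∈ convexHull ℝ F, ∑ i, c i * y i ≤ α) →
      G = {y ∈ convexHull ℝ F | ∑ i, c i * y i = α} → α < ∑ i, c i * y i := by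
  have hfaces := SK_faces_finite F hF
  have hQc : IsCompact (convexHull ℝ F) := hF.isCompact_convexHull (𝕜 := ℝ)
  have hQconv : Convex ℝ (convexHull ℝ F) := convex_convexHull ℝ F
  have hQne : (convexHull ℝ F).Nonempty := hne.mono (subset_convexHull ℝ F)
  generalize convexHull ℝ F = Q at *
  obtain ⟨z0, hz0⟩ := hQne
  set s : Set (κ → ℝ) := (fun q => q - z0) '' Q with hs
  set D := Submodule.span ℝ s with hD
  have hyD : y - z0 ∈ D := by
    let ℓ : ((κ → ℝ) × ℝ) →ₗ[ℝ] (κ → ℝ) :=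
      LinearMap.fst ℝ _ _ - (LinearMap.toSpanSingleton ℝ _ z0) ∘ₗ LinearMap.snd ℝ _ _
    have hsub : Submodule.span ℝ ((fun q : κ → ℝ => (q, (1 : ℝ))) '' Q) ≤ D.comap ℓ := by
      rw [Submodule.span_le]
      rintro _ ⟨q, hq, rfl⟩
      have : q - z0 ∈ D := Submodule.subset_span ⟨q, hq, rfl⟩
      simpa [ℓ] using this
    have := hsub hy
    simpa [ℓ] using this
  set Q' : Set D := (Subtype.val) ⁻¹' s with hQ'
  have hmemQ' : ∀ d : D, d ∈ Q' ↔ z0 + (d : κ → ℝ) ∈ Q := by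
    intro d
    constructor
    · rintro ⟨q, hq, hqd⟩
      have : z0 + (d : κ → ℝ) = q := by rw [← hqd]; simp
      rw [this]; exact hq
    · intro h
      exact ⟨_, h, by simp⟩
  have hQ'conv : Convex ℝ Q' := by
    intro a ha b hb u v hu hv huv
    rw [hmemQ'] at *
    have := hQconv ha hb hu hv huv
    convert this using 1
    have h1 : z0 = u • z0 + v • z0 := by rw [← add_smul, huv, one_smul]
    simp only [Submodule.coe_add, Submodule.coe_smul, smul_add]
    conv_lhs => rw [h1]
    abel
  have h0Q' : (0 : D) ∈ Q' := by rw [hmemQ']; simpa using hz0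
  have hspan : Submodule.span ℝ Q' = ⊤ := Submodule.span_span_coe_preimage
  have haff : affineSpan ℝ Q' = ⊤ := by
    rw [AffineSubspace.affineSpan_eq_top_iff_vectorSpan_eq_top_of_nonempty ℝ D D ⟨0, h0Q'⟩,
      vectorSpan_eq_span_vsub_set_right ℝ h0Q']
    simpa using hspan
  have hint : (interior Q').Nonempty := hQ'conv.interior_nonempty_iff_affineSpan_eq_top.2 haff
  obtain ⟨z, hz⟩ := hint
  have hQ'closed : IsClosed Q' := by
    have : Q' = (fun d : D => z0 + (d : κ → ℝ)) ⁻¹' Q := by ext d; exact hmemQ' d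
    rw [this]
    exact hQc.isClosed.preimage (by fun_prop)
  set y' : D := ⟨y - z0, hyD⟩ with hy'
  have hy'Q : y' ∉ Q' := by rw [hmemQ']; simpa [hy'] using hyQ
  set g : ℝ → D := fun t => z + t • (y' - z) with hg
  have hgc : Continuous g := by fun_prop
  have hcomp : IsCompact (Set.Icc (0 : ℝ) 1 ∩ g ⁻¹' Q') :=
    isCompact_Icc.inter_right (hQ'closed.preimage hgc)
  obtain ⟨t, ⟨⟨ht0, ht1⟩, htQ⟩, htmax⟩ := hcomp.exists_isGreatest
    ⟨0, by simp, by simpa [hg] using interior_subset hz⟩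
  have ht1' : t < 1 := by
    rcases ht1.lt_or_eq with h | h
    · exact h
    · exfalso; apply hy'Q
      have : g t = y' := by simp [hg, h]
      rw [← this]; exact htQ
  set p := g t with hp
  have hpint : p ∉ interior Q' := by
    intro hpi
    have hop : IsOpen (g ⁻¹' interior Q') := isOpen_interior.preimage hgc
    obtain ⟨δ, hδ, hball⟩ := Metric.isOpen_iff.1 hop t hpi
    set t' := min (t + δ / 2) 1 with ht'
    have htt' : t < t' := lt_min (by linarith) ht1'
    have hm : t' ∈ Metric.ball t δ := by
      rw [Metric.mem_ball, Real.dist_eq, abs_of_pos (by linarith)]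
      have : t' ≤ t + δ / 2 := min_le_left _ _
      linarith
    have := htmax ⟨⟨by linarith, min_le_right _ _⟩, (interior_subset (hball hm) : g t' ∈ Q')⟩
    linarith
  obtain ⟨f, hf⟩ := geometric_hahn_banach_open_point hQ'conv.interior isOpen_interior hpint
  have hfQ : ∀ q ∈ Q', f q ≤ f p := by
    intro q hq
    have hcl : Q' ⊆ closure (interior Q') := by
      rw [hQ'conv.closure_interior_eq_closure_of_nonempty_interior ⟨z, hz⟩]
      exact subset_closure
    have : closure (interior Q') ⊆ {q | f q ≤ f p} :=
      closure_minimal (fun a ha => (hf a ha).le) (isClosed_le f.continuous continuous_const)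
    exact this (hcl hq)
  obtain ⟨f', hf'⟩ := LinearMap.exists_extend (p := D) (f : D →ₗ[ℝ] ℝ)
  have hf'D : ∀ d : D, f' (d : κ → ℝ) = f d := fun d => LinearMap.congr_fun hf' d
  obtain ⟨c, hc⟩ := SK_dot f'
  have hlift : ∀ q ∈ Q, ∃ d ∈ Q', q = z0 + (d : κ → ℝ) := by
    intro q hq
    have hqD : q - z0 ∈ D := Submodule.subset_span ⟨q, hq, rfl⟩
    refine ⟨⟨q - z0, hqD⟩, ?_, by simp⟩
    rw [hmemQ']; simpa using hq
  have hpQ : z0 + (p : κ → ℝ) ∈ Q := (hmemQ' p).1 htQ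
  have hzQ : z0 + (z : κ → ℝ) ∈ Q := (hmemQ' z).1 (interior_subset hz)
  set G0 : Set (κ → ℝ) := {y ∈ Q | ∑ i, c i * y i = f' z0 + f p} with hG0
  have hG0f : IsExposedFace Q G0 := by
    refine ⟨fun x hx => hx.1, c, f' z0 + f p, ?_, rfl⟩
    intro q hq
    obtain ⟨d, hd, rfl⟩ := hlift q hq
    rw [hc, map_add, hf'D]
    have := hfQ d hd
    linarith
  have hpG0 : z0 + (p : κ → ℝ) ∈ G0 := by
    refine ⟨hpQ, ?_⟩
    rw [hc, map_add, hf'D]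
  have hG0ne : G0 ≠ Q := by
    intro h
    have : z0 + (z : κ → ℝ) ∈ G0 := h ▸ hzQ
    have h2 := this.2
    rw [hc, map_add, hf'D] at h2
    have := hf z hz
    linarith
  have hfin : {G : Set (κ → ℝ) | IsExposedFace Q G ∧ G.Nonempty ∧ G ≠ Q}.Finite :=
    hfaces.subset (fun G hG => hG.1)
  obtain ⟨G, hG0G, hGmax⟩ := hfin.exists_le_maximal (a := G0) ⟨hG0f, ⟨_, hpG0⟩, hG0ne⟩
  refine ⟨G, ⟨hGmax.1.1, hGmax.1.2.1, hGmax.1.2.2, ?_⟩, ?_⟩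
  · intro F' h1 h2 h3 h4
    exact Set.Subset.antisymm (hGmax.2 ⟨h1, h2, h3⟩ h4) h4
  · intro c₁ α hc₁ hGeq
    change α < SKlin c₁ y
    have hpα : SKlin c₁ (z0 + (p : κ → ℝ)) = α := by
      have := hG0G hpG0
      rw [hGeq] at this
      exact this.2
    have hzα : SKlin c₁ (z0 + (z : κ → ℝ)) < α := by
      apply lt_of_le_of_ne (hc₁ _ hzQ)
      intro heq
      change SKlin c₁ (z0 + (z : κ → ℝ)) = α at heq
      apply hGmax.1.2.2
      apply Set.Subset.antisymm hGmax.1.1.1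
      intro q hq
      rw [hGeq]
      refine ⟨hq, le_antisymm (hc₁ q hq) ?_⟩
      change α ≤ SKlin c₁ q
      obtain ⟨d, hd, rfl⟩ := hlift q hq
      have hcont : Continuous (fun ε : ℝ => z + ε • (z - d)) := by fun_prop
      have hop : IsOpen ((fun ε : ℝ => z + ε • (z - d)) ⁻¹' interior Q') :=
        isOpen_interior.preimage hcont
      obtain ⟨δ, hδ, hball⟩ := Metric.isOpen_iff.1 hop 0 (by simpa using hz)
      have hm : δ / 2 ∈ Metric.ball (0 : ℝ) δ := by
        rw [Metric.mem_ball, Real.dist_eq, sub_zero, abs_of_pos (by linarith)]; linarith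
      have h1 : z + (δ / 2) • (z - d) ∈ Q' := interior_subset (hball hm)
      rw [hmemQ'] at h1
      have h2 : SKlin c₁ _ ≤ α := hc₁ _ h1
      simp only [Submodule.coe_add, Submodule.coe_smul, Submodule.coe_sub, map_add, map_smul,
        map_sub, smul_eq_mul] at h2 heq ⊢
      nlinarith
    have hpe : (p : κ → ℝ) = z + t • ((y - z0) - (z : κ → ℝ)) := by
      simp [hp, hg, hy']
    rw [hpe] at hpα
    simp only [map_add, map_smul, map_sub, smul_eq_mul] at hpα hzα ⊢
    have hpos : 0 < t := by
      rcases ht0.lt_or_eq with h | h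
      · exact h
      · rw [← h] at hpα; linarith
    nlinarith

lemma SK_SF_of_xc {ι : Type*} [Fintype ι] (P : Set (ι → ℝ)) (hP : IsPolytope P)
    (h2 : ∃ a ∈ P, ∃ b ∈ P, a ≠ b) : SKSF P (Fin (xc P)) := by
  have hmem : xc P ∈ {r : ℕ | ∃ (k : ℕ) (Q : Set (Fin k → ℝ)), IsExtension P Q ∧
      polySize Q = r} := by
    apply Nat.sInf_mem
    let e : (Fin (Fintype.card ι) → ℝ) ≃ₗ[ℝ] (ι → ℝ) :=
      LinearEquiv.funCongrLeft ℝ ℝ (Fintype.equivFin ι)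
    obtain ⟨F, hF, rfl⟩ := hP
    refine ⟨_, Fintype.card ι, convexHull ℝ (e.symm '' F), ⟨⟨_, hF.image _, rfl⟩, e, ?_⟩, rfl⟩
    rw [LinearMap.image_convexHull]
    congr 1
    rw [Set.image_image]
    simp
  obtain ⟨k, Q, ⟨⟨F, hF, rfl⟩, π, rfl⟩, hr⟩ := hmem
  set Q := convexHull ℝ F with hQ
  generalize xc (π '' Q) = r at hr
  obtain ⟨_, ⟨q₁, hq₁, rfl⟩, _, ⟨q₂, hq₂, rfl⟩, hπ⟩ := h2
  have hq12 : q₁ ≠ q₂ := fun h => hπ (by rw [h])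
  have hFne : F.Nonempty := by
    rw [← convexHull_nonempty_iff (𝕜 := ℝ)]; exact ⟨q₁, hq₁⟩
  have hfin : {G | IsFacet Q G}.Finite := (SK_faces_finite F hF).subset (fun G hG => hG.1)
  have : Finite {G | IsFacet Q G} := hfin
  have hcard : Nat.card {G | IsFacet Q G} = r := hr
  let φ : {G | IsFacet Q G} ≃ Fin r := Finite.equivFinOfCardEq hcard
  have hch : ∀ i : Fin r, ∃ cα : (Fin k → ℝ) × ℝ, (∀ y ∈ Q, ∑ j, cα.1 j * y j ≤ cα.2) ∧
      (φ.symm i : Set (Fin k → ℝ)) = {y ∈ Q | ∑ j, cα.1 j * y j = cα.2} := by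
    intro i
    obtain ⟨_, c, α, h1, h2⟩ := (φ.symm i).2.1
    exact ⟨(c, α), h1, h2⟩
  choose cα hcα1 hcα2 using hch
  set L := Submodule.span ℝ ((fun q : Fin k → ℝ => (q, (1 : ℝ))) '' Q) with hL
  have hQL : ∀ q ∈ Q, (q, (1 : ℝ)) ∈ L := fun q hq => Submodule.subset_span ⟨q, hq, rfl⟩
  have hK1 : ∀ y, (y, (1 : ℝ)) ∈ L → (∀ i, SKlin (cα i).1 y ≤ (cα i).2) → y ∈ Q := by
    intro y hy hi
    by_contra hyQ
    obtain ⟨G, hG, hGc⟩ := SK_rep F hF hFne y hy hyQ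
    have h1 := hGc (cα (φ ⟨G, hG⟩)).1 (cα (φ ⟨G, hG⟩)).2 (hcα1 _) (by
      rw [← hcα2]; simp)
    have h2 := hi (φ ⟨G, hG⟩)
    change _ < SKlin (cα (φ ⟨G, hG⟩)).1 y at h1
    linarith
  have hQval : ∀ q ∈ Q, ∀ i, SKlin (cα i).1 q ≤ (cα i).2 := fun q hq i => hcα1 i q hq
  have hQc : IsCompact Q := hF.isCompact_convexHull (𝕜 := ℝ)
  obtain ⟨R0, hR0, hR⟩ := hQc.isBounded.exists_pos_norm_le
  have hzero : ∀ y, (y, (0 : ℝ)) ∈ L → (∀ i, SKlin (cα i).1 y ≤ 0) → y = 0 := by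
    intro y hy hi
    by_contra hy0
    have hny : 0 < ‖y‖ := norm_pos_iff.2 hy0
    have key : ∀ l : ℝ, 0 ≤ l → l * ‖y‖ ≤ 2 * R0 := by
      intro l hl
      have hmem : q₁ + l • y ∈ Q := by
        apply hK1
        · have := L.add_mem (hQL q₁ hq₁) (L.smul_mem l hy)
          simpa using this
        · intro i
          rw [map_add, map_smul, smul_eq_mul]
          have := hQval q₁ hq₁ i
          have := hi i
          nlinarith
      have h1 := hR _ hmem
      have h2 := hR _ hq₁
      have h3 : l * ‖y‖ = ‖(q₁ + l • y) - q₁‖ := by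
        rw [add_sub_cancel_left, norm_smul, Real.norm_of_nonneg hl]
      rw [h3]
      exact (norm_sub_le _ _).trans (by linarith)
    have := key ((2 * R0 + 1) / ‖y‖) (by positivity)
    rw [div_mul_cancel₀ _ hny.ne'] at this
    linarith
  have hbound : ∀ y t, (y, t) ∈ L → (∀ i, SKlin (cα i).1 y ≤ t * (cα i).2) →
      0 ≤ t ∧ ‖y‖ ≤ R0 * t := by
    intro y t hy hi
    rcases lt_trichotomy t 0 with ht | ht | ht
    · exfalso
      have hh : ∀ q ∈ Q, y = t • q := by
        intro q hq
        have : y + (-t) • q = 0 := by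
          apply hzero
          · have := L.add_mem hy (L.smul_mem (-t) (hQL q hq))
            simpa using this
          · intro i
            rw [map_add, map_smul, smul_eq_mul]
            have := hQval q hq i
            have := hi i
            nlinarith
        rw [neg_smul] at this
        exact sub_eq_zero.1 (by rw [sub_eq_add_neg]; exact this)
      have h3 : t • q₁ = t • q₂ := (hh _ hq₁).symm.trans (hh _ hq₂)
      exact hq12 (smul_right_injective _ ht.ne h3)
    · subst ht
      have := hzero y hy (fun i => by simpa using hi i)
      simp [this]
    · refine ⟨ht.le, ?_⟩
      have hmem : t⁻¹ • y ∈ Q := by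
        apply hK1
        · have := L.smul_mem t⁻¹ hy
          simpa [ht.ne'] using this
        · intro i
          rw [map_smul, smul_eq_mul]
          rw [inv_mul_le_iff₀ ht]
          exact hi i
      have h1 := hR _ hmem
      rw [norm_smul, norm_inv, Real.norm_of_nonneg ht.le, inv_mul_le_iff₀ ht] at h1
      linarith
  let ψ : ((Fin k → ℝ) × ℝ) →ₗ[ℝ] ((ι → ℝ) × (Fin r → ℝ) × ℝ) :=
    (π ∘ₗ LinearMap.fst ℝ _ _).prod ((LinearMap.pi (fun i =>
      (cα i).2 • LinearMap.snd ℝ _ _ - SKlin (cα i).1 ∘ₗ LinearMap.fst ℝ _ _)).prod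
      (LinearMap.snd ℝ _ _))
  have hψ : ∀ y t, ψ (y, t) = (π y, (fun i => (cα i).2 * t - SKlin (cα i).1 y), t) := by
    intro y t; rfl
  let ψc := LinearMap.toContinuousLinearMap ψ
  have hψn : ∀ v, ‖ψ v‖ ≤ ‖ψc‖ * ‖v‖ := fun v => ψc.le_opNorm v
  refine ⟨L.map ψ, (‖ψc‖ + 1) * (R0 + 1), by positivity, ?_, ?_⟩
  · intro x
    constructor
    · rintro ⟨q, hq, rfl⟩
      refine ⟨fun i => (cα i).2 * 1 - SKlin (cα i).1 q, ?_, (q, 1), hQL q hq, hψ _ _⟩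
      intro i
      have := hQval q hq i
      linarith
    · rintro ⟨s, hs, ⟨y, t⟩, hyL, hyt⟩
      rw [hψ] at hyt
      simp only [Prod.mk.injEq] at hyt
      obtain ⟨rfl, rfl, rfl⟩ := hyt
      refine ⟨y, hK1 y hyL (fun i => ?_), rfl⟩
      have := hs i
      simp only at this
      linarith
  · rintro x s t hs ⟨⟨y, t'⟩, hyL, hyt⟩
    have hyt' := hyt
    rw [hψ] at hyt
    simp only [Prod.mk.injEq] at hyt
    obtain ⟨hx1, hs1, rfl⟩ := hyt
    obtain ⟨ht, hy⟩ := hbound y t' hyL (fun i => by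
      have := hs i
      rw [← hs1] at this
      simp only at this
      linarith)
    have h1 := hψn (y, t')
    rw [hyt'] at h1
    have h2 : ‖((y, t') : (Fin k → ℝ) × ℝ)‖ ≤ (R0 + 1) * t' := by
      rw [Prod.norm_def]
      refine max_le (hy.trans (by nlinarith)) ?_
      simp only [Real.norm_of_nonneg ht]; nlinarith
    have h3 : ‖(x, s, t')‖ ≤ (‖ψc‖ + 1) * (R0 + 1) * t' := by
      refine h1.trans ?_
      rw [mul_assoc]
      apply mul_le_mul (by linarith) h2 (norm_nonneg _) (by positivity)
    exact ⟨(norm_fst_le (x, s, t')).trans h3,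
      ((norm_fst_le (s, t')).trans (norm_snd_le (x, s, t'))).trans h3⟩

lemma SK_scale {ι : Type*} [Fintype ι] {σ : Type} [Fintype σ] {P : Set (ι → ℝ)}
    {W : Submodule ℝ ((ι → ℝ) × (σ → ℝ) × ℝ)}
    (hP : ∀ x, x ∈ P ↔ ∃ s : σ → ℝ, (∀ i, 0 ≤ s i) ∧ (x, s, (1 : ℝ)) ∈ W)
    {x s t} (ht : 0 < t) (hs : ∀ i, 0 ≤ s i) (h : (x, s, t) ∈ W) : t⁻¹ • x ∈ P := by
  rw [hP]
  refine ⟨t⁻¹ • s, fun i => mul_nonneg (inv_nonneg.2 ht.le) (hs i), ?_⟩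
  have := W.smul_mem t⁻¹ h
  simpa [ht.ne'] using this

lemma SK_balas {ι : Type*} [Fintype ι] (P₁ P₂ : Set (ι → ℝ)) (σ τ : Type) [Fintype σ]
    [Fintype τ] (h₁ : SKSF P₁ σ) (h₂ : SKSF P₂ τ) (hc₁ : Convex ℝ P₁) (hc₂ : Convex ℝ P₂)
    (hn₁ : P₁.Nonempty) (hn₂ : P₂.Nonempty) : SKSF (convexHull ℝ (P₁ ∪ P₂)) (σ ⊕ τ) := by
  obtain ⟨W₁, R₁, hR₁, hP₁, hb₁⟩ := h₁
  obtain ⟨W₂, R₂, hR₂, hP₂, hb₂⟩ := h₂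
  let W : Submodule ℝ ((ι → ℝ) × (σ ⊕ τ → ℝ) × ℝ) :=
    { carrier := {a | ∃ y z t₁ t₂, (y, (fun i => a.2.1 (Sum.inl i)), t₁) ∈ W₁ ∧
        (z, (fun i => a.2.1 (Sum.inr i)), t₂) ∈ W₂ ∧ a.1 = y + z ∧ a.2.2 = t₁ + t₂}
      add_mem' := by
        rintro a b ⟨y, z, t₁, t₂, h1, h2, h3, h4⟩ ⟨y', z', t₁', t₂', h1', h2', h3', h4'⟩
        refine ⟨y + y', z + z', t₁ + t₁', t₂ + t₂', W₁.add_mem h1 h1', W₂.add_mem h2 h2', ?_, ?_⟩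
        · rw [Prod.fst_add, h3, h3']; abel
        · rw [Prod.snd_add, Prod.snd_add, h4, h4']; ring
      zero_mem' := ⟨0, 0, 0, 0, W₁.zero_mem, W₂.zero_mem, by simp, by simp⟩
      smul_mem' := by
        rintro c a ⟨y, z, t₁, t₂, h1, h2, h3, h4⟩
        refine ⟨c • y, c • z, c • t₁, c • t₂, W₁.smul_mem c h1, W₂.smul_mem c h2, ?_, ?_⟩
        · rw [Prod.smul_fst, h3, smul_add]
        · rw [Prod.smul_snd, Prod.smul_snd, h4, smul_add] }
  have ht₁ : ∀ x s t, (∀ i, 0 ≤ s i) → (x, s, t) ∈ W₁ → 0 ≤ t := by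
    intro x s t hs h
    have := (norm_nonneg x).trans (hb₁ x s t hs h).1
    exact nonneg_of_mul_nonneg_right this hR₁
  have ht₂ : ∀ x s t, (∀ i, 0 ≤ s i) → (x, s, t) ∈ W₂ → 0 ≤ t := by
    intro x s t hs h
    have := (norm_nonneg x).trans (hb₂ x s t hs h).1
    exact nonneg_of_mul_nonneg_right this hR₂
  refine ⟨W, R₁ + R₂, by positivity, ?_, ?_⟩
  · intro x
    constructor
    · intro hx
      rw [hc₁.convexHull_union hc₂ hn₁ hn₂, mem_convexJoin] at hx
      obtain ⟨y, hy, z, hz, a, b, ha, hb, hab, rfl⟩ := hx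
      obtain ⟨s, hs, hsW⟩ := (hP₁ y).1 hy
      obtain ⟨u, hu, huW⟩ := (hP₂ z).1 hz
      refine ⟨Sum.elim (a • s) (b • u), ?_, a • y, b • z, a, b, ?_, ?_, rfl, hab.symm⟩
      · rintro (i | i)
        · exact mul_nonneg ha (hs i)
        · exact mul_nonneg hb (hu i)
      · have := W₁.smul_mem a hsW
        rw [Prod.smul_mk, Prod.smul_mk, smul_eq_mul, mul_one] at this
        exact this
      · have := W₂.smul_mem b huW
        rw [Prod.smul_mk, Prod.smul_mk, smul_eq_mul, mul_one] at this
        exact this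
    · rintro ⟨s, hs, y, z, t₁, t₂, h1, h2, h3, h4⟩
      simp only at h1 h2 h3 h4
      have hp1 := ht₁ _ _ _ (fun i => hs _) h1
      have hp2 := ht₂ _ _ _ (fun i => hs _) h2
      have b1 := (hb₁ _ _ _ (fun i => hs _) h1).1
      have b2 := (hb₂ _ _ _ (fun i => hs _) h2).1
      rcases hp1.eq_or_lt with e1 | e1
      · have hy : y = 0 := by rw [← e1] at b1; simpa using b1
        have e2 : t₂ = 1 := by linarith
        subst e2
        rw [h3, hy, zero_add]
        exact subset_convexHull ℝ _ (Or.inr ((hP₂ z).2 ⟨_, fun i => hs _, h2⟩))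
      rcases hp2.eq_or_lt with e2 | e2
      · have hz : z = 0 := by rw [← e2] at b2; simpa using b2
        have e2 : t₁ = 1 := by linarith
        subst e2
        rw [h3, hz, add_zero]
        exact subset_convexHull ℝ _ (Or.inl ((hP₁ y).2 ⟨_, fun i => hs _, h1⟩))
      have m1 := SK_scale hP₁ e1 (fun i => hs _) h1
      have m2 := SK_scale hP₂ e2 (fun i => hs _) h2
      have := (convex_convexHull ℝ (P₁ ∪ P₂)) (subset_convexHull ℝ _ (Or.inl m1))
        (subset_convexHull ℝ _ (Or.inr m2)) e1.le e2.le h4.symm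
      rw [smul_inv_smul₀ e1.ne', smul_inv_smul₀ e2.ne'] at this
      rw [h3]; exact this
  · rintro x s t hs ⟨y, z, t₁, t₂, h1, h2, h3, h4⟩
    simp only at h1 h2 h3 h4
    have hp1 := ht₁ _ _ _ (fun i => hs _) h1
    have hp2 := ht₂ _ _ _ (fun i => hs _) h2
    have b1 := hb₁ _ _ _ (fun i => hs _) h1
    have b2 := hb₂ _ _ _ (fun i => hs _) h2
    have q1 : 0 ≤ R₁ * t₂ := by positivity
    have q2 : 0 ≤ R₂ * t₁ := by positivity
    have q3 : 0 ≤ R₁ * t₁ := by positivity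
    have q4 : 0 ≤ R₂ * t₂ := by positivity
    rw [h3, h4]
    constructor
    · refine (norm_add_le _ _).trans ?_
      nlinarith [b1.1, b2.1]
    · rw [pi_norm_le_iff_of_nonneg (by positivity)]
      rintro (i | i)
      · have : ‖s (Sum.inl i)‖ ≤ _ := (norm_le_pi_norm (fun i => s (Sum.inl i)) i).trans b1.2
        nlinarith
      · have : ‖s (Sum.inr i)‖ ≤ _ := (norm_le_pi_norm (fun i => s (Sum.inr i)) i).trans b2.2
        nlinarith

lemma SK_fiber {V : Type*} [Fintype V] (A B : Set V) [Fintype A] [Fintype B]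
    (P₁ : Set (A → ℝ)) (P₂ : Set (B → ℝ)) (σ τ : Type) [Fintype σ]
    [Fintype τ] (h₁ : SKSF P₁ σ) (h₂ : SKSF P₂ τ) :
    SKSF {x : V → ℝ | (fun a : A => x a) ∈ P₁ ∧ (fun b : B => x b) ∈ P₂ ∧
      ∀ v, v ∉ A → v ∉ B → x v = 0} (σ ⊕ τ) := by
  obtain ⟨W₁, R₁, hR₁, hP₁, hb₁⟩ := h₁
  obtain ⟨W₂, R₂, hR₂, hP₂, hb₂⟩ := h₂
  let W : Submodule ℝ ((V → ℝ) × (σ ⊕ τ → ℝ) × ℝ) :=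
    { carrier := {a | ((fun v : A => a.1 v), (fun i => a.2.1 (Sum.inl i)), a.2.2) ∈ W₁ ∧
        ((fun v : B => a.1 v), (fun i => a.2.1 (Sum.inr i)), a.2.2) ∈ W₂ ∧
        ∀ v, v ∉ A → v ∉ B → a.1 v = 0}
      add_mem' := by
        rintro a b ⟨h1, h2, h3⟩ ⟨h1', h2', h3'⟩
        refine ⟨W₁.add_mem h1 h1', W₂.add_mem h2 h2', fun v hA hB => ?_⟩
        rw [Prod.fst_add, Pi.add_apply, h3 v hA hB, h3' v hA hB, add_zero]
      zero_mem' := ⟨W₁.zero_mem, W₂.zero_mem, fun _ _ _ => rfl⟩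
      smul_mem' := by
        rintro c a ⟨h1, h2, h3⟩
        refine ⟨W₁.smul_mem c h1, W₂.smul_mem c h2, fun v hA hB => ?_⟩
        rw [Prod.smul_fst, Pi.smul_apply, h3 v hA hB, smul_zero] }
  refine ⟨W, R₁ + R₂, by positivity, ?_, ?_⟩
  · intro x
    constructor
    · rintro ⟨h1, h2, h3⟩
      obtain ⟨s, hs, hsW⟩ := (hP₁ _).1 h1
      obtain ⟨u, hu, huW⟩ := (hP₂ _).1 h2
      refine ⟨Sum.elim s u, ?_, hsW, huW, h3⟩
      rintro (i | i)
      · exact hs i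
      · exact hu i
    · rintro ⟨s, hs, h1, h2, h3⟩
      exact ⟨(hP₁ _).2 ⟨_, fun i => hs _, h1⟩, (hP₂ _).2 ⟨_, fun i => hs _, h2⟩, h3⟩
  · rintro x s t hs ⟨h1, h2, h3⟩
    simp only at h1 h2 h3
    have b1 := hb₁ _ _ _ (fun i => hs _) h1
    have b2 := hb₂ _ _ _ (fun i => hs _) h2
    have ht : 0 ≤ t := nonneg_of_mul_nonneg_right ((norm_nonneg _).trans b1.1) hR₁
    have q1 : 0 ≤ R₁ * t := by positivity
    have q2 : 0 ≤ R₂ * t := by positivity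
    constructor
    · rw [pi_norm_le_iff_of_nonneg (by positivity)]
      intro v
      by_cases hA : v ∈ A
      · have := (norm_le_pi_norm (fun v : A => x v) ⟨v, hA⟩).trans b1.1
        simp only at this
        linarith
      by_cases hB : v ∈ B
      · have := (norm_le_pi_norm (fun v : B => x v) ⟨v, hB⟩).trans b2.1
        simp only at this
        linarith
      rw [h3 v hA hB, norm_zero]; positivity
    · rw [pi_norm_le_iff_of_nonneg (by positivity)]
      rintro (i | i)
      · have : ‖s (Sum.inl i)‖ ≤ _ := (norm_le_pi_norm (fun i => s (Sum.inl i)) i).trans b1.2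
        linarith
      · have : ‖s (Sum.inr i)‖ ≤ _ := (norm_le_pi_norm (fun i => s (Sum.inr i)) i).trans b2.2
        linarith

lemma SK_stab_SF {V : Type*} [Fintype V] (G : SimpleGraph V) (v : V) :
    SKSF (stab G) (Fin (xc (stab G))) := by
  apply SK_SF_of_xc _ ⟨_, SK_stab_finite G, rfl⟩
  refine ⟨(∅ : Set V).indicator 1, subset_convexHull ℝ _ ⟨∅, by simp, rfl⟩,
    ({v} : Set V).indicator 1, subset_convexHull ℝ _ ⟨{v}, by simp, rfl⟩, ?_⟩
  intro h
  have := congrFun h v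
  simp at this

/-- the piece of the stable set polytope supported on `A ∪ B ∪ C`, glued along `A` -/
def SKpiece {V : Type*} (G : SimpleGraph V) (A B : Set V) [Fintype A] [Fintype B] :
    Set (V → ℝ) :=
  {x : V → ℝ | (fun a : A => x a) ∈ stab (G.induce A) ∧
      (fun b : B => x b) ∈ stab (G.induce B) ∧ ∀ v, v ∉ A → v ∉ B → x v = 0}

lemma SK_piece_conv {V : Type*} (G : SimpleGraph V) (A B : Set V) [Fintype A] [Fintype B] :
    Convex ℝ (SKpiece G A B) := by
  rintro x ⟨h1, h2, h3⟩ y ⟨h1', h2', h3'⟩ a b ha hb hab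
  refine ⟨convex_convexHull ℝ _ h1 h1' ha hb hab, convex_convexHull ℝ _ h2 h2' ha hb hab, ?_⟩
  intro v hA hB
  simp [h3 v hA hB, h3' v hA hB]

lemma SK_restrict {V : Type*} (G : SimpleGraph V) (A : Set V) [Fintype A] (S : Set V)
    (hS : ∀ u ∈ S, ∀ v ∈ S, ¬ G.Adj u v) :
    (fun a : A => (S.indicator 1 : V → ℝ) a) ∈ stab (G.induce A) := by
  apply subset_convexHull ℝ _
  refine ⟨{a : A | (a : V) ∈ S}, fun u hu v hv h => hS _ hu _ hv h, ?_⟩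
  ext a
  by_cases h : (a : V) ∈ S <;> simp [Set.indicator, h]

lemma SK_piece_ind {V : Type*} (G : SimpleGraph V) (A B : Set V) [Fintype A] [Fintype B]
    (S : Set V) (hS : ∀ u ∈ S, ∀ v ∈ S, ¬ G.Adj u v) (hsub : S ⊆ A ∪ B) :
    (S.indicator 1 : V → ℝ) ∈ SKpiece G A B := by
  refine ⟨SK_restrict G A S hS, SK_restrict G B S hS, ?_⟩
  intro v hA hB
  apply Set.indicator_of_notMem
  intro h
  rcases hsub h with h | h
  · exact hA h
  · exact hB h

open Classical in
lemma SK_piece_sub {V : Type*} [Fintype V] (G : SimpleGraph V) (hG : IsPerfect G)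
    (A B : Set V) [Fintype A] [Fintype B]
    (hAB : ∀ u ∈ A, u ∉ B → ∀ v ∈ B, v ∉ A → ¬ G.Adj u v) :
    SKpiece G A B ⊆ stab G := by
  rintro x ⟨h1, h2, h3⟩
  obtain ⟨p1, c1⟩ := SK_stab_sub _ _ h1
  obtain ⟨p2, c2⟩ := SK_stab_sub _ _ h2
  have side : ∀ (C : Set V) [Fintype C], (∀ K : Finset C, (G.induce C).IsClique (K : Set C) →
      ∑ v ∈ K, x v ≤ 1) → ∀ K : Finset V, G.IsClique (K : Set V) →
      (∀ v ∈ K, v ∉ C → x v = 0) → ∑ v ∈ K, x v ≤ 1 := by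
    intro C _ hC K hK h0
    have h4 := hC (K.subtype (· ∈ C)) (by
      intro a ha b hb hab
      rw [Finset.mem_coe, Finset.mem_subtype] at ha hb
      exact hK ha hb (fun h => hab (Subtype.ext h)))
    rw [Finset.sum_subtype_eq_sum_filter (s := K) (p := (· ∈ C)) (f := x),
      Finset.sum_filter_of_ne] at h4
    · exact h4
    · intro v hv hne
      by_contra hvC
      exact hne (h0 v hv hvC)
  apply SK_mem_stab G hG
  · intro v
    by_cases hA : v ∈ A
    · exact p1 ⟨v, hA⟩
    by_cases hB : v ∈ B
    · exact p2 ⟨v, hB⟩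
    rw [h3 v hA hB]
  · intro K hK
    by_cases hc : ∃ v ∈ K, v ∈ B ∧ v ∉ A
    · obtain ⟨b, hbK, hbB, hbA⟩ := hc
      apply side B c2 K hK
      intro v hv hvB
      by_cases hvA : v ∈ A
      · exfalso
        have hne : v ≠ b := by rintro rfl; exact hvB hbB
        exact hAB v hvA hvB b hbB hbA (hK hv hbK hne)
      · exact h3 v hvA hvB
    · push Not at hc
      apply side A c1 K hK
      intro v hv hvA
      exact h3 v hvA (fun hB => hvA (hc v hv hB))

/-- for a perfect graph `G` admitting a skew partition `(A₁, B₁, A₂, B₂)`,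
`xc (STAB G) ≤ 2 ⬝ xc (STAB G[A₁ ∪ B₁]) + 2 ⬝ xc (STAB G[A₂ ∪ B₂]) +
xc (STAB G[A₁ ∪ B₂]) + xc (STAB G[A₂ ∪ B₁])`. -/
theorem xc_stab_skew_partition {V : Type*} [Fintype V] (G : SimpleGraph V)
    (hG : IsPerfect G) (A₁ B₁ A₂ B₂ : Set V)
    [Fintype ↥(A₁ ∪ B₁)] [Fintype ↥(A₂ ∪ B₂)] [Fintype ↥(A₁ ∪ B₂)] [Fintype ↥(A₂ ∪ B₁)]
    (hskew : IsSkewPartition G A₁ B₁ A₂ B₂) :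
    xc (stab G) ≤
      2 * xc (stab (G.induce (A₁ ∪ B₁))) + 2 * xc (stab (G.induce (A₂ ∪ B₂))) +
        xc (stab (G.induce (A₁ ∪ B₂))) + xc (stab (G.induce (A₂ ∪ B₁))) := by
  classical
  obtain ⟨hA₁, hB₁, hA₂, hB₂, hun, d1, d2, d3, d4, d5, d6, hadj, hnadj⟩ := hskew
  obtain ⟨a₁, ha₁⟩ := hA₁
  obtain ⟨a₂, ha₂⟩ := hA₂
  have s11 := SK_stab_SF (G.induce (A₁ ∪ B₁)) ⟨a₁, Or.inl ha₁⟩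
  have s12 := SK_stab_SF (G.induce (A₁ ∪ B₂)) ⟨a₁, Or.inl ha₁⟩
  have s22 := SK_stab_SF (G.induce (A₂ ∪ B₂)) ⟨a₂, Or.inl ha₂⟩
  have s21 := SK_stab_SF (G.induce (A₂ ∪ B₁)) ⟨a₂, Or.inl ha₂⟩
  have f1 := SK_fiber _ _ _ _ _ _ s11 s12
  have f2 := SK_fiber _ _ _ _ _ _ s22 s21
  have z1 : (SKpiece G (A₁ ∪ B₁) (A₁ ∪ B₂)).Nonempty :=
    ⟨_, SK_piece_ind G _ _ ∅ (by simp) (by simp)⟩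
  have z2 : (SKpiece G (A₂ ∪ B₂) (A₂ ∪ B₁)).Nonempty :=
    ⟨_, SK_piece_ind G _ _ ∅ (by simp) (by simp)⟩
  have hb := SK_balas (SKpiece G (A₁ ∪ B₁) (A₁ ∪ B₂)) (SKpiece G (A₂ ∪ B₂) (A₂ ∪ B₁)) _ _ f1 f2
    (SK_piece_conv G _ _) (SK_piece_conv G _ _) z1 z2
  have heq : convexHull ℝ (SKpiece G (A₁ ∪ B₁) (A₁ ∪ B₂) ∪ SKpiece G (A₂ ∪ B₂) (A₂ ∪ B₁))
      = stab G := by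
    apply Set.Subset.antisymm
    · apply convexHull_min _ (convex_convexHull ℝ _)
      apply Set.union_subset
      · apply SK_piece_sub G hG
        rintro u (hu | hu) hu' v (hv | hv) hv'
        · exact absurd (Or.inl hu) hu'
        · exact absurd (Or.inl hu) hu'
        · exact absurd (Or.inl hv) hv'
        · exact hnadj u hu v hv
      · apply SK_piece_sub G hG
        rintro u (hu | hu) hu' v (hv | hv) hv'
        · exact absurd (Or.inl hu) hu'
        · exact absurd (Or.inl hu) hu'
        · exact absurd (Or.inl hv) hv'
        · exact fun h => hnadj v hv u hu h.symm
    · apply convexHull_min _ (convex_convexHull ℝ _)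
      rintro _ ⟨S, hS, rfl⟩
      have hcov : ∀ v, ((v ∈ A₁ ∨ v ∈ B₁) ∨ v ∈ A₂) ∨ v ∈ B₂ := by
        intro v
        have : v ∈ A₁ ∪ B₁ ∪ A₂ ∪ B₂ := hun ▸ Set.mem_univ v
        exact this
      apply subset_convexHull ℝ _
      by_cases hSA : ∃ v ∈ S, v ∈ A₁
      · obtain ⟨u, huS, huA⟩ := hSA
        left
        apply SK_piece_ind G _ _ S hS
        intro v hv
        rcases hcov v with ((h | h) | h) | h
        · exact Or.inl (Or.inl h)
        · exact Or.inl (Or.inr h)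
        · exact absurd (hadj u huA v h) (hS u huS v hv)
        · exact Or.inr (Or.inr h)
      · push Not at hSA
        right
        apply SK_piece_ind G _ _ S hS
        intro v hv
        rcases hcov v with ((h | h) | h) | h
        · exact absurd h (hSA v hv)
        · exact Or.inr (Or.inr h)
        · exact Or.inl (Or.inl h)
        · exact Or.inl (Or.inr h)
  rw [heq] at hb
  have := SK_xc_le _ _ hb
  simp only [Fintype.card_sum, Fintype.card_fin] at this
  omega
end
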